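/- arXiv:1302.0584 — 5 statements merged into one kernel-verified Lean document; each statement's English description precedes it below -/
import Mathlib

section
/- Let p > 3 be a prime and let G = Φ₁₃(1⁶) be the group of order p⁶ with presentation on generators α₁, α₂, α₃, α₄, β₁, β₂ and relations [α₁,α₂] = β₁, [α₁,α₃] = β₂, [α₂,α₄] = β₂, α₁ᵖ = α₂ᵖ = α₃ᵖ = α₄ᵖ = β₁ᵖ = β₂ᵖ = 1, with every commutator of a pair of generators not listed among these relations declared trivial. Then the Bogomolov multiplier B₀(G) is trivial. -/
/-!
Φ₁₃(1⁶): `B₀` of the group of order `p⁶` with relations [α₁,α₂]=β₁, [α₁,α₃]=β₂, [α₂,α₄]=β₂,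
all generators of order p, all other commutators trivial, is trivial.
-/

namespace Stmt0

/-- The additive group `ℚ/ℤ`. -/
abbrev QZ : Type := ℚ ⧸ AddSubgroup.zmultiples (1 : ℚ)

/-- An inhomogeneous 2-cocycle on `G` with values in `ℚ/ℤ` (trivial `G`-action). -/
def IsTwoCocycle {G : Type} [Group G] (f : G → G → QZ) : Prop :=
  ∀ g h j : G, f h j - f (g * h) j + f g (h * j) - f g h = 0

/-- An inhomogeneous 2-coboundary on `G` with values in `ℚ/ℤ` (trivial `G`-action). -/
def IsTwoCoboundary {G : Type} [Group G] (f : G → G → QZ) : Prop :=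
  ∃ c : G → QZ, ∀ g h : G, f g h = c h - c (g * h) + c g

/-- A subgroup is bicyclic if it is abelian and generated by at most two elements
(equivalently, cyclic or a direct product of two cyclic groups). -/
def IsBicyclic {G : Type} [Group G] (A : Subgroup G) : Prop :=
  (∀ x y : A, x * y = y * x) ∧ ∃ a b : G, A = Subgroup.closure {a, b}

/-- The Bogomolov multiplier `B₀(G) ⊆ H²(G, ℚ/ℤ)` is trivial, phrased at the level of
2-cocycles: every 2-cocycle whose restriction to each bicyclic subgroup is a coboundary
(i.e. whose class restricts to zero on each bicyclic subgroup) is itself a coboundary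
(i.e. its class is zero). -/
def BogomolovMultiplierIsTrivial (G : Type) [Group G] : Prop :=
  ∀ f : G → G → QZ, IsTwoCocycle f →
    (∀ A : Subgroup G, IsBicyclic A → IsTwoCoboundary (fun a b : ↥A => f ↑a ↑b)) →
    IsTwoCoboundary f

/-- The Bogomolov multiplier `B₀(G) ⊆ H²(G, ℚ/ℤ)` is nontrivial, phrased at the level of
2-cocycles. -/
def BogomolovMultiplierIsNontrivial (G : Type) [Group G] : Prop :=
  ∃ f : G → G → QZ, IsTwoCocycle f ∧
    (∀ A : Subgroup G, IsBicyclic A → IsTwoCoboundary (fun a b : ↥A => f ↑a ↑b)) ∧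
    ¬ IsTwoCoboundary f

/-- The generators. -/
inductive Gen | a1 | a2 | a3 | a4 | b1 | b2

open FreeGroup

/-- The commutator `[x,y] = x⁻¹y⁻¹xy`. -/
def c (x y : FreeGroup Gen) : FreeGroup Gen := x⁻¹ * y⁻¹ * x * y

/-- The defining relators. -/
def rels (p : ℕ) : Set (FreeGroup Gen) :=
  { c (of .a1) (of .a2) * (of Gen.b1)⁻¹,
    c (of .a1) (of .a3) * (of Gen.b2)⁻¹,
    c (of .a2) (of .a4) * (of Gen.b2)⁻¹,
    c (of .a1) (of .a4),
    c (of .a1) (of .b1),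
    c (of .a1) (of .b2),
    c (of .a2) (of .a3),
    c (of .a2) (of .b1),
    c (of .a2) (of .b2),
    c (of .a3) (of .a4),
    c (of .a3) (of .b1),
    c (of .a3) (of .b2),
    c (of .a4) (of .b1),
    c (of .a4) (of .b2),
    c (of .b1) (of .b2),
    (of Gen.a1) ^ p,
    (of Gen.a2) ^ p,
    (of Gen.a3) ^ p,
    (of Gen.a4) ^ p,
    (of Gen.b1) ^ p,
    (of Gen.b2) ^ p }

section CommutatorIdentities

variable {E : Type*} [Group E]

theorem conj_eq_mul_inv_commutator (x y : E) :
    x⁻¹ * y * x = y * (x⁻¹ * y⁻¹ * x * y)⁻¹ := by group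

/-- If `[x, y]` commutes with `x` and `y`, its order divides every exponent killing `x`. -/
theorem commutator_pow_eq_one {x y : E} {n : ℕ} (hx : x ^ n = 1)
    (h : Commute x (x⁻¹ * y⁻¹ * x * y)) : (x⁻¹ * y⁻¹ * x * y) ^ n = 1 := by
  have hconj : y⁻¹ * x * y⁻¹⁻¹ = x * (x⁻¹ * y⁻¹ * x * y) := by group
  have hpow := conj_pow (i := n) (a := y⁻¹) (b := x)
  rw [hconj, h.mul_pow, hx] at hpow
  simpa using hpow

/-- In a nilpotency-class-two situation, `x * y⁻¹` commutes with `z * w` exactly when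
`[x, z] = [y, w]`, provided the mixed commutators `[x, w]` and `[y, z]` vanish. -/
theorem commute_mul_inv_mul_iff {x y z w : E} (hxw : Commute x w) (hyz : Commute y z)
    (hw : Commute (x⁻¹ * z⁻¹ * x * z) w) :
    Commute (x * y⁻¹) (z * w) ↔ y⁻¹ * w⁻¹ * y * w = x⁻¹ * z⁻¹ * x * z := by
  have hx : x⁻¹ * (z * w) * x = z * w * (x⁻¹ * z⁻¹ * x * z)⁻¹ := by
    calc x⁻¹ * (z * w) * x = (x⁻¹ * z * x) * (x⁻¹ * (w * x)) := by group
      _ = z * ((x⁻¹ * z⁻¹ * x * z)⁻¹ * w) := by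
        rw [conj_eq_mul_inv_commutator x z, ← hxw.eq, inv_mul_cancel_left, mul_assoc]
      _ = z * w * (x⁻¹ * z⁻¹ * x * z)⁻¹ := by rw [hw.inv_left.eq, ← mul_assoc z w]
  have hy : y⁻¹ * (z * w) * y = z * w * (y⁻¹ * w⁻¹ * y * w)⁻¹ := by
    calc y⁻¹ * (z * w) * y = (y⁻¹ * z) * (w * y) := by group
      _ = z * (y⁻¹ * w * y) := by rw [hyz.inv_left.eq]; group
      _ = z * w * (y⁻¹ * w⁻¹ * y * w)⁻¹ := by
        rw [conj_eq_mul_inv_commutator y w, mul_assoc z w]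
  have key : Commute (x * y⁻¹) (z * w) ↔ y⁻¹ * (z * w) * y = x⁻¹ * (z * w) * x := by
    constructor
    · intro h
      calc y⁻¹ * (z * w) * y = x⁻¹ * ((x * y⁻¹) * (z * w)) * y := by group
        _ = x⁻¹ * (z * w) * x := by rw [h.eq]; group
    · intro h
      calc x * y⁻¹ * (z * w) = x * (y⁻¹ * (z * w) * y) * y⁻¹ := by group
        _ = z * w * (x * y⁻¹) := by rw [h]; group
  rw [key, hx, hy, mul_right_inj, inv_inj]

end CommutatorIdentities

/-- The group `ℚ/ℤ` is divisible. -/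
theorem QZ.exists_nsmul_eq {n : ℕ} (hn : n ≠ 0) (t : QZ) : ∃ a : QZ, n • a = t := by
  obtain ⟨r, rfl⟩ := QuotientAddGroup.mk_surjective t
  refine ⟨((r / n : ℚ) : QZ), ?_⟩
  rw [← QuotientAddGroup.mk_nsmul, nsmul_eq_mul, mul_div_cancel₀ _ (Nat.cast_ne_zero.mpr hn)]

section CocycleExtension

variable {G : Type} [Group G] {f : G → G → QZ}

theorem IsTwoCocycle.map_one_left (hf : IsTwoCocycle f) (g : G) : f 1 g = f 1 1 := by
  have h := hf 1 1 g
  simp only [one_mul, sub_self, zero_add] at h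
  exact sub_eq_zero.mp h

theorem IsTwoCocycle.map_one_right (hf : IsTwoCocycle f) (g : G) : f g 1 = f 1 1 := by
  have h := hf g 1 1
  simp only [mul_one, sub_add_cancel] at h
  exact (sub_eq_zero.mp h).symm

/-- The central extension of `G` by `ℚ/ℤ` attached to a 2-cocycle. -/
@[ext]
structure CocycleExtension (hf : IsTwoCocycle f) where
  /-- The image in `G`. -/
  base : G
  /-- The coordinate in `ℚ/ℤ`. -/
  fiber : QZ

namespace CocycleExtension

variable {hf : IsTwoCocycle f}

instance : Mul (CocycleExtension hf) :=
  ⟨fun x y => ⟨x.base * y.base, x.fiber + y.fiber + f x.base y.base⟩⟩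

instance : One (CocycleExtension hf) := ⟨⟨1, -f 1 1⟩⟩

instance : Inv (CocycleExtension hf) :=
  ⟨fun x => ⟨x.base⁻¹, -x.fiber - f x.base⁻¹ x.base - f 1 1⟩⟩

@[simp] theorem base_mul (x y : CocycleExtension hf) : (x * y).base = x.base * y.base := rfl

@[simp] theorem fiber_mul (x y : CocycleExtension hf) :
    (x * y).fiber = x.fiber + y.fiber + f x.base y.base := rfl

@[simp] theorem base_one : (1 : CocycleExtension hf).base = 1 := rfl

@[simp] theorem fiber_one : (1 : CocycleExtension hf).fiber = -f 1 1 := rfl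

@[simp] theorem base_inv (x : CocycleExtension hf) : x⁻¹.base = x.base⁻¹ := rfl

@[simp] theorem fiber_inv (x : CocycleExtension hf) :
    x⁻¹.fiber = -x.fiber - f x.base⁻¹ x.base - f 1 1 := rfl

instance : Group (CocycleExtension hf) :=
  Group.ofLeftAxioms
    (fun x y z => by
      ext
      · simp [mul_assoc]
      · have h := hf x.base y.base z.base
        simp only [fiber_mul, base_mul]
        rw [← sub_eq_zero, ← neg_eq_zero, ← h]
        abel)
    (fun x => by
      ext
      · simp
      · simp [hf.map_one_left])
    (fun x => by
      ext
      · simp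
      · simp only [fiber_mul, fiber_inv, base_inv, fiber_one]
        abel)

/-- The projection of the extension onto `G`. -/
@[simps]
def proj (hf : IsTwoCocycle f) : CocycleExtension hf →* G where
  toFun := base
  map_one' := rfl
  map_mul' _ _ := rfl

/-- A homomorphic section of the extension trivialises the cocycle. -/
theorem isTwoCoboundary_of_section (s : G →* CocycleExtension hf)
    (hs : (proj hf).comp s = MonoidHom.id G) : IsTwoCoboundary f := by
  have hbase (g : G) : (s g).base = g := DFunLike.congr_fun hs g
  refine ⟨fun g => -(s g).fiber, fun g h => ?_⟩
  simp only [_root_.map_mul, fiber_mul, hbase]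
  abel

/-- If the class of `f` restricts trivially to bicyclic subgroups, then commuting elements of `G`
have commuting lifts. -/
theorem commute_of_commute_base
    (hB : ∀ A : Subgroup G, IsBicyclic A → IsTwoCoboundary (fun a b : ↥A => f ↑a ↑b))
    {x y : CocycleExtension hf} (h : Commute x.base y.base) : Commute x y := by
  have hcomm : ∀ u v : Subgroup.closure {x.base, y.base}, u * v = v * u := by
    have hgen : ∀ u ∈ ({x.base, y.base} : Set G), ∀ v ∈ ({x.base, y.base} : Set G),
        u * v = v * u := by
      rintro u (rfl | rfl) v (rfl | rfl)
      exacts [rfl, h.eq, h.eq.symm, rfl]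
    have := Subgroup.isMulCommutative_closure hgen
    exact mul_comm'
  obtain ⟨b, hb⟩ := hB (Subgroup.closure {x.base, y.base}) ⟨hcomm, x.base, y.base, rfl⟩
  let u : Subgroup.closure {x.base, y.base} := ⟨x.base, Subgroup.subset_closure (by simp)⟩
  let v : Subgroup.closure {x.base, y.base} := ⟨y.base, Subgroup.subset_closure (by simp)⟩
  have huv : f x.base y.base = b v - b (u * v) + b u := hb u v
  have hvu : f y.base x.base = b u - b (v * u) + b v := hb v u
  ext
  · exact h.eq
  · rw [fiber_mul, fiber_mul, huv, hvu, hcomm u v]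
    abel

/-- The inclusion of the kernel `ℚ/ℤ` into the extension. -/
def incl (hf : IsTwoCocycle f) : Multiplicative QZ →* CocycleExtension hf where
  toFun a := ⟨1, a.toAdd - f 1 1⟩
  map_one' := by ext <;> simp
  map_mul' a b := by
    ext
    · simp
    · simp only [fiber_mul, toAdd_mul]
      abel

theorem commute_incl (x : CocycleExtension hf) (a : Multiplicative QZ) :
    Commute x (incl hf a) := by
  ext
  · simp [incl]
  · simp only [incl, MonoidHom.coe_mk, OneHom.coe_mk, fiber_mul, hf.map_one_left,
      hf.map_one_right]
    abel

theorem exists_incl_eq_of_base_eq_one {x : CocycleExtension hf} (hx : x.base = 1) :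
    ∃ a, incl hf a = x := by
  refine ⟨Multiplicative.ofAdd (x.fiber + f 1 1), ?_⟩
  ext
  · exact hx.symm
  · simp [incl]

/-- An element killed by `n ≠ 0` has a lift killed by `n`, because `ℚ/ℤ` is divisible. -/
theorem exists_lift_pow_eq_one (hf : IsTwoCocycle f) {n : ℕ} (hn : n ≠ 0) {g : G}
    (hg : g ^ n = 1) : ∃ x : CocycleExtension hf, x.base = g ∧ x ^ n = 1 := by
  let x₀ : CocycleExtension hf := ⟨g, 0⟩
  have hx₀ : (x₀ ^ n).base = 1 := by
    rw [← proj_apply, map_pow]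
    exact hg
  obtain ⟨t, ht⟩ := exists_incl_eq_of_base_eq_one hx₀
  obtain ⟨a, ha⟩ := QZ.exists_nsmul_eq hn (-t.toAdd)
  refine ⟨x₀ * incl hf (Multiplicative.ofAdd a), ?_, ?_⟩
  · simp [incl, x₀]
  · rw [(commute_incl _ _).mul_pow, ← ht, ← map_pow, ← _root_.map_mul, ← ofAdd_nsmul, ha]
    simp

end CocycleExtension

end CocycleExtension

section Presentation

variable {p : ℕ}

/-- The generators of `Φ₁₃(1⁶)`. -/
abbrev gen (p : ℕ) (i : Gen) : PresentedGroup (rels p) := PresentedGroup.of i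

theorem commute_of_commutator_eq_one {E : Type*} [Group E] {x y : E}
    (h : x⁻¹ * y⁻¹ * x * y = 1) : Commute x y := by
  have h' : (y * x)⁻¹ * (x * y) = 1 := by rw [mul_inv_rev, ← h]; group
  exact (inv_mul_eq_one.mp h').symm

theorem commutator_eq_one_of_commute {E : Type*} [Group E] {x y : E}
    (h : Commute x y) : x⁻¹ * y⁻¹ * x * y = 1 := by
  rw [mul_assoc, h.eq]
  group

theorem commute_gen {i j : Gen} (h : c (of i) (of j) ∈ rels p) :
    Commute (gen p i) (gen p j) :=
  commute_of_commutator_eq_one (PresentedGroup.one_of_mem h)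

theorem commutator_gen {i j k : Gen} (h : c (of i) (of j) * (of k)⁻¹ ∈ rels p) :
    (gen p i)⁻¹ * (gen p j)⁻¹ * gen p i * gen p j = gen p k :=
  mul_inv_eq_one.mp (PresentedGroup.one_of_mem h)

theorem gen_pow {i : Gen} (h : of i ^ p ∈ rels p) : gen p i ^ p = 1 :=
  PresentedGroup.one_of_mem h

variable {E : Type*} [Group E] {F : Gen → E}

theorem lift_commutator_eq_one {i j : Gen} (h : Commute (F i) (F j)) :
    FreeGroup.lift F (c (of i) (of j)) = 1 := by
  simpa [c] using commutator_eq_one_of_commute h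

theorem lift_commutator_mul_inv_eq_one {i j k : Gen}
    (h : (F i)⁻¹ * (F j)⁻¹ * F i * F j = F k) :
    FreeGroup.lift F (c (of i) (of j) * (of k)⁻¹) = 1 := by
  simpa [c, mul_inv_eq_one] using h

theorem lift_pow_eq_one {i : Gen} (h : F i ^ p = 1) : FreeGroup.lift F (of i ^ p) = 1 := by
  simpa using h

end Presentation

theorem bogomolov_trivial_Phi13 (p : ℕ) (hp : p.Prime) (h3 : 3 < p)
    (hcard : Nat.card (PresentedGroup (rels p)) = p ^ 6) :
    BogomolovMultiplierIsTrivial (PresentedGroup (rels p)) := by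
  intro f hf hB
  have hcomm {x y : CocycleExtension hf} (h : Commute x.base y.base) : Commute x y :=
    CocycleExtension.commute_of_commute_base hB h
  have hlift {i : Gen} (h : of i ^ p ∈ rels p) :=
    CocycleExtension.exists_lift_pow_eq_one hf hp.ne_zero (gen_pow h)
  obtain ⟨x₁, hx₁, hp₁⟩ := hlift (i := .a1) (by simp [rels])
  obtain ⟨x₂, hx₂, hp₂⟩ := hlift (i := .a2) (by simp [rels])
  obtain ⟨x₃, hx₃, hp₃⟩ := hlift (i := .a3) (by simp [rels])
  obtain ⟨x₄, hx₄, hp₄⟩ := hlift (i := .a4) (by simp [rels])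
  let F : Gen → CocycleExtension hf
    | .a1 => x₁
    | .a2 => x₂
    | .a3 => x₃
    | .a4 => x₄
    | .b1 => x₁⁻¹ * x₂⁻¹ * x₁ * x₂
    | .b2 => x₁⁻¹ * x₃⁻¹ * x₁ * x₃
  have h12 : (gen p .a1)⁻¹ * (gen p .a2)⁻¹ * gen p .a1 * gen p .a2 = gen p .b1 :=
    commutator_gen (by simp [rels])
  have h13 : (gen p .a1)⁻¹ * (gen p .a3)⁻¹ * gen p .a1 * gen p .a3 = gen p .b2 :=
    commutator_gen (by simp [rels])
  have h24 : (gen p .a2)⁻¹ * (gen p .a4)⁻¹ * gen p .a2 * gen p .a4 = gen p .b2 :=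
    commutator_gen (by simp [rels])
  have hbase (i : Gen) : (F i).base = gen p i := by
    cases i
    case b1 => simpa [F, hx₁, hx₂] using h12
    case b2 => simpa [F, hx₁, hx₃] using h13
    all_goals assumption
  have hF {i j : Gen} (h : c (of i) (of j) ∈ rels p) : Commute (F i) (F j) :=
    hcomm (by rw [hbase, hbase]; exact commute_gen h)
  have hFc {i j : Gen} (h : c (of i) (of j) ∈ rels p) :
      FreeGroup.lift F (c (of i) (of j)) = 1 :=
    lift_commutator_eq_one (hF h)
  have hβ₂ : x₂⁻¹ * x₄⁻¹ * x₂ * x₄ = x₁⁻¹ * x₃⁻¹ * x₁ * x₃ := by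
    refine (commute_mul_inv_mul_iff (hF (i := .a1) (j := .a4) (by simp [rels]))
      (hF (i := .a2) (j := .a3) (by simp [rels]))
      (hF (i := .a4) (j := .b2) (by simp [rels])).symm).mp (hcomm ?_)
    simp only [CocycleExtension.base_mul, CocycleExtension.base_inv, hbase]
    have h14 : Commute (gen p .a1) (gen p .a4) := commute_gen (by simp [rels])
    have h23 : Commute (gen p .a2) (gen p .a3) := commute_gen (by simp [rels])
    have h4 : Commute (gen p .a4) (gen p .b2) := commute_gen (by simp [rels])
    exact (commute_mul_inv_mul_iff h14 h23 (h13 ▸ h4.symm)).mpr (h24.trans h13.symm)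
  have hrels : ∀ r ∈ rels p, FreeGroup.lift F r = 1 := by
    intro r hr
    have hr' := hr
    simp only [rels, Set.mem_insert_iff, Set.mem_singleton_iff] at hr'
    rcases hr' with rfl | rfl | rfl | rfl | rfl | rfl | rfl | rfl | rfl | rfl | rfl | rfl | rfl |
      rfl | rfl | rfl | rfl | rfl | rfl | rfl | rfl
    exacts [lift_commutator_mul_inv_eq_one rfl, lift_commutator_mul_inv_eq_one rfl,
      lift_commutator_mul_inv_eq_one hβ₂, hFc hr, hFc hr, hFc hr, hFc hr, hFc hr, hFc hr, hFc hr,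
      hFc hr, hFc hr, hFc hr, hFc hr, hFc hr, lift_pow_eq_one hp₁, lift_pow_eq_one hp₂,
      lift_pow_eq_one hp₃, lift_pow_eq_one hp₄,
      lift_pow_eq_one (commutator_pow_eq_one hp₁ (hF (i := .a1) (j := .b1) (by simp [rels]))),
      lift_pow_eq_one (commutator_pow_eq_one hp₁ (hF (i := .a1) (j := .b2) (by simp [rels])))]
  refine CocycleExtension.isTwoCoboundary_of_section (PresentedGroup.toGroup hrels) ?_
  ext i
  simpa using hbase i

end Stmt0
end

section
/- Let p > 3 be a prime and let G = Φ₂₂(1⁶) be the group of order p⁶ with presentation on generators α, α₁, α₂, α₃, β₁, β₂ and relations [α₁,α] = α₂, [α₂,α] = α₃, [β₁,β₂] = α₃, α₁ᵖ·α₂^C(p,2)·α₃^C(p,3) = 1, αᵖ = α₂ᵖ = α₃ᵖ = β₁ᵖ = β₂ᵖ = 1, with every commutator of a pair of generators not listed among these relations declared trivial (C(n,k) denotes the binomial coefficient). Then the Bogomolov multiplier B₀(G) is trivial. -/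
/-!
Φ₂₂(1⁶): relations [α₁,α]=α₂, [α₂,α]=α₃, [β₁,β₂]=α₃, α₁ᵖα₂^C(p,2)α₃^C(p,3)=1,
αᵖ=α₂ᵖ=α₃ᵖ=β₁ᵖ=β₂ᵖ=1.
-/

namespace Stmt2

/-- The additive group `ℚ/ℤ`. -/
abbrev QZ : Type := ℚ ⧸ AddSubgroup.zmultiples (1 : ℚ)

/-- An inhomogeneous 2-cocycle on `G` with values in `ℚ/ℤ` (trivial `G`-action). -/
def IsTwoCocycle {G : Type} [Group G] (f : G → G → QZ) : Prop :=
  ∀ g h j : G, f h j - f (g * h) j + f g (h * j) - f g h = 0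

/-- An inhomogeneous 2-coboundary on `G` with values in `ℚ/ℤ` (trivial `G`-action). -/
def IsTwoCoboundary {G : Type} [Group G] (f : G → G → QZ) : Prop :=
  ∃ c : G → QZ, ∀ g h : G, f g h = c h - c (g * h) + c g

/-- A subgroup is bicyclic if it is abelian and generated by at most two elements
(equivalently, cyclic or a direct product of two cyclic groups). -/
def IsBicyclic {G : Type} [Group G] (A : Subgroup G) : Prop :=
  (∀ x y : A, x * y = y * x) ∧ ∃ a b : G, A = Subgroup.closure {a, b}

/-- The Bogomolov multiplier `B₀(G) ⊆ H²(G, ℚ/ℤ)` is trivial, phrased at the level of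
2-cocycles: every 2-cocycle whose restriction to each bicyclic subgroup is a coboundary
(i.e. whose class restricts to zero on each bicyclic subgroup) is itself a coboundary
(i.e. its class is zero). -/
def BogomolovMultiplierIsTrivial (G : Type) [Group G] : Prop :=
  ∀ f : G → G → QZ, IsTwoCocycle f →
    (∀ A : Subgroup G, IsBicyclic A → IsTwoCoboundary (fun a b : ↥A => f ↑a ↑b)) →
    IsTwoCoboundary f

/-- The Bogomolov multiplier `B₀(G) ⊆ H²(G, ℚ/ℤ)` is nontrivial, phrased at the level of
2-cocycles. -/
def BogomolovMultiplierIsNontrivial (G : Type) [Group G] : Prop :=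
  ∃ f : G → G → QZ, IsTwoCocycle f ∧
    (∀ A : Subgroup G, IsBicyclic A → IsTwoCoboundary (fun a b : ↥A => f ↑a ↑b)) ∧
    ¬ IsTwoCoboundary f

/-- The generators. -/
inductive Gen | a | a1 | a2 | a3 | b1 | b2

open FreeGroup

/-- The commutator `[x,y] = x⁻¹y⁻¹xy`. -/
def c (x y : FreeGroup Gen) : FreeGroup Gen := x⁻¹ * y⁻¹ * x * y

/-- The defining relators. -/
def rels (p : ℕ) : Set (FreeGroup Gen) :=
  { c (of .a1) (of .a) * (of Gen.a2)⁻¹,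
    c (of .a2) (of .a) * (of Gen.a3)⁻¹,
    c (of .b1) (of .b2) * (of Gen.a3)⁻¹,
    c (of .a) (of .a3),
    c (of .a) (of .b1),
    c (of .a) (of .b2),
    c (of .a1) (of .a2),
    c (of .a1) (of .a3),
    c (of .a1) (of .b1),
    c (of .a1) (of .b2),
    c (of .a2) (of .a3),
    c (of .a2) (of .b1),
    c (of .a2) (of .b2),
    c (of .a3) (of .b1),
    c (of .a3) (of .b2),
    (of Gen.a1) ^ p * (of Gen.a2) ^ (p.choose 2) * (of Gen.a3) ^ (p.choose 3),
    (of Gen.a) ^ p,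
    (of Gen.a2) ^ p,
    (of Gen.a3) ^ p,
    (of Gen.b1) ^ p,
    (of Gen.b2) ^ p }

/-- If conjugation by `g` sends `x` to `x * y` with `y` commuting with `x`, and `g` commutes with
`x ^ n`, then `y ^ n = 1`. -/
theorem pow_eq_one_of_semiconjBy {E : Type*} [Group E] {g x y : E} {n : ℕ}
    (h : SemiconjBy g (x * y) x) (hxy : Commute x y) (hg : Commute g (x ^ n)) : y ^ n = 1 := by
  have h1 := h.pow_right n
  rw [hxy.mul_pow] at h1
  have h2 : g * (x ^ n * y ^ n) = g * x ^ n := h1.eq.trans hg.eq.symm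
  simpa using h2

theorem semiconjBy_of_commutator_eq {E : Type*} [Group E] {x g y : E}
    (h : x⁻¹ * g⁻¹ * x * g = y) : SemiconjBy g (x * y) x := by
  subst h
  simp [SemiconjBy, mul_assoc]

theorem commutator_eq_one_of_commute {E : Type*} [Group E] {x y : E} (h : Commute x y) :
    x⁻¹ * y⁻¹ * x * y = 1 := by
  rw [mul_assoc, h.eq]
  group

theorem commute_of_commutator_eq_one {E : Type*} [Group E] {x y : E}
    (h : x⁻¹ * y⁻¹ * x * y = 1) : Commute x y := by
  have := semiconjBy_of_commutator_eq h
  rw [mul_one] at this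
  exact Commute.symm this

theorem commutator_mul_central {E : Type*} [Group E] {x g w : E} (hw : ∀ y, Commute w y) :
    (x * w)⁻¹ * g⁻¹ * (x * w) * g = x⁻¹ * g⁻¹ * x * g := by
  rw [mul_inv_rev, mul_assoc w⁻¹, mul_assoc w⁻¹, mul_assoc w⁻¹, inv_mul_eq_iff_eq_mul,
    (hw _).eq]
  simp only [mul_assoc]
  rw [(hw g).eq]

theorem mul_mul_mul_eq_of_semiconjBy {F : Type*} [Group F] {a a2 a3 b1 b2 : F}
    (h : SemiconjBy a (a2 * a3) a2) (hab : Commute a b2) (h1 : Commute a3 b1)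
    (h2 : Commute a3 b2) : a2 * b2 * (a * b1) = a * a2 * (b2 * b1) * a3 :=
  calc a2 * b2 * (a * b1) = a2 * (b2 * a) * b1 := by simp only [mul_assoc]
    _ = (a2 * a) * b2 * b1 := by rw [← hab.eq]; simp only [mul_assoc]
    _ = a * a2 * (a3 * (b2 * b1)) := by rw [← h.eq]; simp only [mul_assoc]
    _ = a * a2 * (b2 * b1) * a3 := by rw [(h2.mul_right h1).eq]; simp only [mul_assoc]

theorem mul_mul_mul_eq_of_semiconjBy' {F : Type*} [Group F] {a a2 b1 b2 k : F}
    (h : SemiconjBy b2 (b1 * k) b1) (hab : Commute a2 b1) :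
    a * b1 * (a2 * b2) = a * a2 * (b2 * b1) * k :=
  calc a * b1 * (a2 * b2) = a * (b1 * a2) * b2 := by simp only [mul_assoc]
    _ = a * a2 * (b1 * b2) := by rw [← hab.eq]; simp only [mul_assoc]
    _ = a * a2 * (b2 * b1) * k := by rw [← h.eq]; simp only [mul_assoc]

/-- Elements of order dividing `p` lift to elements of order dividing `p` in an extension with
`p`-divisible kernel in which commuting elements lift to commuting elements. -/
theorem exists_lift_pow_eq_one {E G : Type*} [Group E] [Group G] {π : E →* G} {p : ℕ}
    (hsurj : Function.Surjective π)
    (hdiv : ∀ z, π z = 1 → ∃ w, π w = 1 ∧ w ^ p = z)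
    (hcomm : ∀ x y, Commute (π x) (π y) → Commute x y) {g : G} (hg : g ^ p = 1) :
    ∃ x, π x = g ∧ x ^ p = 1 := by
  obtain ⟨x, rfl⟩ := hsurj g
  obtain ⟨w, hw, hwp⟩ := hdiv (x ^ p)⁻¹ (by simp [hg])
  have hc : Commute x w := hcomm _ _ (by simp [hw])
  exact ⟨x * w, by simp [hw], by rw [hc.mul_pow, hwp, mul_inv_cancel]⟩

/-- The defining relations hold for lifts of the generators along an extension with `p`-divisible
kernel in which commuting elements lift to commuting elements. -/
theorem exists_lift_rels {p : ℕ} (hp : p.Prime) (h3 : 3 < p) {E G : Type*} [Group E] [Group G]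
    {π : E →* G} (hsurj : Function.Surjective π)
    (hdiv : ∀ z, π z = 1 → ∃ w, π w = 1 ∧ w ^ p = z)
    (hcomm : ∀ x y, Commute (π x) (π y) → Commute x y)
    (φ : FreeGroup Gen →* G) (hφ : ∀ r ∈ rels p, φ r = 1) :
    ∃ ψ : FreeGroup Gen →* E, π.comp ψ = φ ∧ ∀ r ∈ rels p, ψ r = 1 := by
  simp only [rels, c, Set.mem_insert_iff, Set.mem_singleton_iff, forall_eq_or_imp, forall_eq,
    _root_.map_mul, _root_.map_inv, map_pow, mul_inv_eq_one] at hφ ⊢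
  obtain ⟨r12, r2, rb, ra3, rab1, rab2, r112, r113, r11, r112', r23, r21, r22, r31, r32, rp1,
    rpa, rp2, rp3, rpb1, rpb2⟩ := hφ
  obtain ⟨a, ha, hap⟩ := exists_lift_pow_eq_one hsurj hdiv hcomm rpa
  obtain ⟨b1, hb1, hb1p⟩ := exists_lift_pow_eq_one hsurj hdiv hcomm rpb1
  obtain ⟨b2, hb2, hb2p⟩ := exists_lift_pow_eq_one hsurj hdiv hcomm rpb2
  obtain ⟨x, hx⟩ := hsurj (φ (of Gen.a1))
  obtain ⟨a2, ha2⟩ : ∃ y, x⁻¹ * a⁻¹ * x * a = y := ⟨_, rfl⟩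
  obtain ⟨a3, ha3⟩ : ∃ y, a2⁻¹ * a⁻¹ * a2 * a = y := ⟨_, rfl⟩
  have hπ2 : π a2 = φ (of Gen.a2) := by
    rw [← r12, ← ha2]; simp [hx, ha]
  have hπ3 : π a3 = φ (of Gen.a3) := by
    rw [← r2, ← ha3]; simp [hπ2, ha]
  obtain ⟨w, hw, hwp⟩ := hdiv (x ^ p * (a2 ^ p.choose 2 * a3 ^ p.choose 3))⁻¹
    (by simp only [_root_.map_inv, _root_.map_mul, map_pow, hx, hπ2, hπ3, ← mul_assoc, rp1, inv_one])
  have hwc : ∀ y, Commute w y := fun y => hcomm _ _ (by simp [hw])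
  obtain ⟨a1, ha1⟩ : ∃ y, x * w = y := ⟨_, rfl⟩
  have hπ1 : π a1 = φ (of Gen.a1) := by
    rw [← ha1]; simp [hx, hw]
  have e12 : a1⁻¹ * a⁻¹ * a1 * a = a2 := by
    rw [← ha1, commutator_mul_central hwc, ha2]
  have e1p : a1 ^ p * (a2 ^ p.choose 2 * a3 ^ p.choose 3) = 1 := by
    rw [← ha1, (hwc x).symm.mul_pow, ← ((hwc x).pow_pow p p).eq, mul_assoc, hwp, inv_mul_cancel]
  have lift {u v : E} (h : (π u)⁻¹ * (π v)⁻¹ * π u * π v = 1) : Commute u v :=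
    hcomm _ _ (commute_of_commutator_eq_one h)
  have ca3 : Commute a a3 := lift (by rw [ha, hπ3]; exact ra3)
  have cab1 : Commute a b1 := lift (by rw [ha, hb1]; exact rab1)
  have cab2 : Commute a b2 := lift (by rw [ha, hb2]; exact rab2)
  have c12 : Commute a1 a2 := lift (by rw [hπ1, hπ2]; exact r112)
  have c13 : Commute a1 a3 := lift (by rw [hπ1, hπ3]; exact r113)
  have c1b1 : Commute a1 b1 := lift (by rw [hπ1, hb1]; exact r11)
  have c1b2 : Commute a1 b2 := lift (by rw [hπ1, hb2]; exact r112')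
  have c23 : Commute a2 a3 := lift (by rw [hπ2, hπ3]; exact r23)
  have c2b1 : Commute a2 b1 := lift (by rw [hπ2, hb1]; exact r21)
  have c2b2 : Commute a2 b2 := lift (by rw [hπ2, hb2]; exact r22)
  have c3b1 : Commute a3 b1 := lift (by rw [hπ3, hb1]; exact r31)
  have c3b2 : Commute a3 b2 := lift (by rw [hπ3, hb2]; exact r32)
  have s1 : SemiconjBy a (a1 * a2) a1 := semiconjBy_of_commutator_eq e12
  have s2 : SemiconjBy a (a2 * a3) a2 := semiconjBy_of_commutator_eq ha3
  have e3 : b1⁻¹ * b2⁻¹ * b1 * b2 = a3 := by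
    obtain ⟨k, hk⟩ : ∃ y, b1⁻¹ * b2⁻¹ * b1 * b2 = y := ⟨_, rfl⟩
    have hπk : π k = π a3 := by
      rw [hπ3, ← rb, ← hk]; simp [hb1, hb2]
    have sb := semiconjBy_of_commutator_eq hk
    have hE : a2 * b2 * (a * b1) = a * b1 * (a2 * b2) := by
      refine (hcomm (a2 * b2) (a * b1) ?_).eq
      have h := mul_mul_mul_eq_of_semiconjBy' (a := π a) (by simpa using sb.map π) (c2b1.map π)
      rw [_root_.map_mul, _root_.map_mul, Commute, SemiconjBy, h, hπk]
      exact mul_mul_mul_eq_of_semiconjBy (by simpa using s2.map π) (cab2.map π) (c3b1.map π)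
        (c3b2.map π)
    rw [mul_mul_mul_eq_of_semiconjBy s2 cab2 c3b1 c3b2, mul_mul_mul_eq_of_semiconjBy' sb c2b1] at hE
    rw [hk]
    exact (mul_left_cancel hE).symm
  have e3p : a3 ^ p = 1 :=
    pow_eq_one_of_semiconjBy (semiconjBy_of_commutator_eq e3) c3b1.symm (by simp [hb1p])
  have caa2 : Commute a (a2 ^ p) := by
    have h := s2.pow_right p
    rwa [c23.mul_pow, e3p, mul_one] at h
  have e2p : a2 ^ p = 1 := by
    refine pow_eq_one_of_semiconjBy s1 c12 ?_
    rw [eq_inv_of_mul_eq_one_left e1p]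
    obtain ⟨m, hm⟩ := hp.dvd_choose_self two_ne_zero (by omega : 2 < p)
    rw [hm, pow_mul]
    exact ((caa2.pow_right m).mul_right (ca3.pow_right _)).inv_right
  refine ⟨FreeGroup.lift fun | .a => a | .a1 => a1 | .a2 => a2 | .a3 => a3 | .b1 => b1 | .b2 => b2,
    ?_, ?_⟩
  · ext g
    cases g <;> simp [ha, hb1, hb2, hπ1, hπ2, hπ3]
  · simp only [FreeGroup.lift_apply_of]
    have ce {u v : E} (h : Commute u v) := commutator_eq_one_of_commute h
    exact ⟨e12, ha3, e3, ce ca3, ce cab1, ce cab2, ce c12, ce c13, ce c1b1, ce c1b2, ce c23,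
      ce c2b1, ce c2b2, ce c3b1, ce c3b2, by rw [mul_assoc, e1p], hap, e2p, e3p, hb1p, hb2p⟩

/-- The underlying set `ℚ/ℤ × G` of the central extension of `G` by `ℚ/ℤ` attached to a
2-cocycle. -/
@[ext]
structure CocycleExtension {G : Type} [Group G] (f : G → G → QZ) (hf : IsTwoCocycle f) where
  /-- The `ℚ/ℤ`-coordinate. -/
  fst : QZ
  /-- The projection to `G`. -/
  snd : G

namespace CocycleExtension

variable {G : Type} [Group G] {f : G → G → QZ} {hf : IsTwoCocycle f}

instance : Mul (CocycleExtension f hf) := ⟨fun x y => ⟨x.fst + y.fst + f x.snd y.snd, x.snd * y.snd⟩⟩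
instance : One (CocycleExtension f hf) := ⟨⟨-f 1 1, 1⟩⟩
instance : Inv (CocycleExtension f hf) :=
  ⟨fun x => ⟨-x.fst - f x.snd⁻¹ x.snd - f 1 1, x.snd⁻¹⟩⟩

@[simp] theorem fst_mul (x y : CocycleExtension f hf) :
    (x * y).fst = x.fst + y.fst + f x.snd y.snd := rfl
@[simp] theorem snd_mul (x y : CocycleExtension f hf) : (x * y).snd = x.snd * y.snd := rfl
@[simp] theorem fst_one : (1 : CocycleExtension f hf).fst = -f 1 1 := rfl
@[simp] theorem snd_one : (1 : CocycleExtension f hf).snd = 1 := rfl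
@[simp] theorem fst_inv (x : CocycleExtension f hf) :
    x⁻¹.fst = -x.fst - f x.snd⁻¹ x.snd - f 1 1 := rfl
@[simp] theorem snd_inv (x : CocycleExtension f hf) : x⁻¹.snd = x.snd⁻¹ := rfl

theorem _root_.Stmt2.IsTwoCocycle.one_left (hf : IsTwoCocycle f) (g : G) : f 1 g = f 1 1 := by
  have h := hf 1 1 g
  simp only [one_mul, sub_self, zero_add] at h
  exact sub_eq_zero.mp h

instance : Group (CocycleExtension f hf) :=
  Group.ofLeftAxioms
    (fun x y z => by
      ext
      · have h := hf x.snd y.snd z.snd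
        simp only [fst_mul, snd_mul]
        rw [← sub_eq_zero, ← neg_eq_zero, ← h]
        abel
      · simp [mul_assoc])
    (fun x => by
      ext
      · simp [hf.one_left]
      · simp)
    (fun x => by
      ext
      · simp only [fst_mul, fst_inv, snd_inv, fst_one]
        abel
      · simp)

/-- The projection of the extension attached to a 2-cocycle. -/
def proj (f : G → G → QZ) (hf : IsTwoCocycle f) : CocycleExtension f hf →* G where
  toFun := snd
  map_one' := rfl
  map_mul' _ _ := rfl

theorem proj_surjective : Function.Surjective (proj f hf) := fun g => ⟨⟨0, g⟩, rfl⟩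

theorem pow_mk_one (u : QZ) (n : ℕ) :
    (⟨u - f 1 1, 1⟩ : CocycleExtension f hf) ^ n = ⟨n • u - f 1 1, 1⟩ := by
  induction n with
  | zero => ext <;> simp
  | succ n ih =>
    rw [pow_succ, ih]
    ext
    · simp only [fst_mul, succ_nsmul]
      abel
    · simp

theorem exists_pow_eq_of_proj_eq_one {n : ℕ} (hn : n ≠ 0) (z : CocycleExtension f hf)
    (hz : proj f hf z = 1) : ∃ w, proj f hf w = 1 ∧ w ^ n = z := by
  obtain ⟨u, g⟩ := z
  obtain rfl : g = 1 := hz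
  obtain ⟨q, hq⟩ := QuotientAddGroup.mk_surjective (u + f 1 1)
  refine ⟨⟨((q / n : ℚ) : QZ) - f 1 1, 1⟩, rfl, ?_⟩
  have h : n • ((q / n : ℚ) : QZ) = u + f 1 1 := by
    rw [← hq, ← QuotientAddGroup.mk_nsmul, nsmul_eq_mul, mul_div_cancel₀ _ (by exact_mod_cast hn)]
  rw [pow_mk_one, h, add_sub_cancel_right]

theorem commute_of_commute_proj (hsymm : ∀ g h, Commute g h → f g h = f h g)
    (x y : CocycleExtension f hf) (h : Commute (proj f hf x) (proj f hf y)) : Commute x y := by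
  refine CocycleExtension.ext ?_ h.eq
  simp only [fst_mul]
  rw [add_comm x.fst, show f x.snd y.snd = f y.snd x.snd from hsymm _ _ h]

/-- A cocycle is a coboundary if its extension splits. -/
theorem isTwoCoboundary_of_section (s : G →* CocycleExtension f hf)
    (hs : (proj f hf).comp s = MonoidHom.id G) : IsTwoCoboundary f := by
  have hsnd : ∀ g, (s g).snd = g := DFunLike.congr_fun hs
  refine ⟨fun g => -(s g).fst, fun g h => ?_⟩
  simp only [_root_.map_mul, fst_mul, hsnd]
  abel

end CocycleExtension

/-- A cocycle which is a coboundary on every bicyclic subgroup is symmetric on commuting pairs. -/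
theorem eq_swap_of_commute {G : Type} [Group G] {f : G → G → QZ}
    (hf : ∀ A : Subgroup G, IsBicyclic A → IsTwoCoboundary (fun a b : ↥A => f ↑a ↑b))
    (g h : G) (hgh : Commute g h) : f g h = f h g := by
  have hA : ∀ x ∈ ({g, h} : Set G), ∀ y ∈ ({g, h} : Set G), x * y = y * x := by
    rintro x (rfl | rfl) y (rfl | rfl)
    exacts [rfl, hgh.eq, hgh.eq.symm, rfl]
  obtain ⟨d, hd⟩ := hf (Subgroup.closure {g, h})
    ⟨(Subgroup.isMulCommutative_closure hA).is_comm.comm, g, h, rfl⟩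
  let g' : Subgroup.closure {g, h} := ⟨g, Subgroup.subset_closure (by simp)⟩
  let h' : Subgroup.closure {g, h} := ⟨h, Subgroup.subset_closure (by simp)⟩
  have hc : g' * h' = h' * g' := Subtype.ext hgh.eq
  have h1 : f g h = d h' - d (g' * h') + d g' := hd g' h'
  have h2 : f h g = d g' - d (h' * g') + d h' := hd h' g'
  rw [h1, h2, hc]
  abel

theorem bogomolov_trivial_Phi22 (p : ℕ) (hp : p.Prime) (h3 : 3 < p)
    (hcard : Nat.card (PresentedGroup (rels p)) = p ^ 6) :
    BogomolovMultiplierIsTrivial (PresentedGroup (rels p)) := by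
  intro f hf hres
  obtain ⟨ψ, hψ, hrel⟩ := exists_lift_rels hp h3 CocycleExtension.proj_surjective
    (CocycleExtension.exists_pow_eq_of_proj_eq_one (hf := hf) hp.ne_zero)
    (CocycleExtension.commute_of_commute_proj (eq_swap_of_commute hres))
    (PresentedGroup.mk (rels p)) fun r hr => PresentedGroup.one_of_mem hr
  have hlift : ∀ r ∈ rels p, FreeGroup.lift (fun x => ψ (of x)) r = 1 := fun r hr => by
    rw [← hrel r hr]
    exact DFunLike.congr_fun (FreeGroup.ext_hom _ _ fun x => FreeGroup.lift_apply_of) r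
  refine CocycleExtension.isTwoCoboundary_of_section (PresentedGroup.toGroup hlift) ?_
  ext x
  rw [MonoidHom.comp_apply, PresentedGroup.toGroup.of]
  exact DFunLike.congr_fun hψ (of x)

end Stmt2
end

section
/- Let p > 3 be a prime and let G = Φ₂₅(222) be the group of order p⁶ with presentation on generators α, α₁, α₂, α₃, α₄ and relations [αᵢ,α] = αᵢ₊₁ for i = 1,2,3, α₁ᵖ·α₂^C(p,2)·α₃^C(p,3)·α₄^C(p,4) = α₃, α₂ᵖ·α₃^C(p,2)·α₄^C(p,3) = α₄, α^(p²) = 1, α₃ᵖ = α₄ᵖ = 1, with every commutator of a pair of generators not listed among these relations declared trivial. Then the Bogomolov multiplier B₀(G) is trivial. -/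
/-!
Φ₂₅(222): relations [αᵢ,α]=αᵢ₊₁ (i=1,2,3), α₁^(p)=α₃, α₂^(p)=α₄, α^(p²)=1, α₃ᵖ=α₄ᵖ=1.
-/

namespace Stmt5

/-- The additive group `ℚ/ℤ`. -/
abbrev QZ : Type := ℚ ⧸ AddSubgroup.zmultiples (1 : ℚ)

/-- An inhomogeneous 2-cocycle on `G` with values in `ℚ/ℤ` (trivial `G`-action). -/
def IsTwoCocycle {G : Type} [Group G] (f : G → G → QZ) : Prop :=
  ∀ g h j : G, f h j - f (g * h) j + f g (h * j) - f g h = 0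

/-- An inhomogeneous 2-coboundary on `G` with values in `ℚ/ℤ` (trivial `G`-action). -/
def IsTwoCoboundary {G : Type} [Group G] (f : G → G → QZ) : Prop :=
  ∃ c : G → QZ, ∀ g h : G, f g h = c h - c (g * h) + c g

/-- A subgroup is bicyclic if it is abelian and generated by at most two elements
(equivalently, cyclic or a direct product of two cyclic groups). -/
def IsBicyclic {G : Type} [Group G] (A : Subgroup G) : Prop :=
  (∀ x y : A, x * y = y * x) ∧ ∃ a b : G, A = Subgroup.closure {a, b}

/-- The Bogomolov multiplier `B₀(G) ⊆ H²(G, ℚ/ℤ)` is trivial, phrased at the level of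
2-cocycles: every 2-cocycle whose restriction to each bicyclic subgroup is a coboundary
(i.e. whose class restricts to zero on each bicyclic subgroup) is itself a coboundary
(i.e. its class is zero). -/
def BogomolovMultiplierIsTrivial (G : Type) [Group G] : Prop :=
  ∀ f : G → G → QZ, IsTwoCocycle f →
    (∀ A : Subgroup G, IsBicyclic A → IsTwoCoboundary (fun a b : ↥A => f ↑a ↑b)) →
    IsTwoCoboundary f

/-- The Bogomolov multiplier `B₀(G) ⊆ H²(G, ℚ/ℤ)` is nontrivial, phrased at the level of
2-cocycles. -/
def BogomolovMultiplierIsNontrivial (G : Type) [Group G] : Prop :=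
  ∃ f : G → G → QZ, IsTwoCocycle f ∧
    (∀ A : Subgroup G, IsBicyclic A → IsTwoCoboundary (fun a b : ↥A => f ↑a ↑b)) ∧
    ¬ IsTwoCoboundary f

/-- The generators. -/
inductive Gen | a | a1 | a2 | a3 | a4

open FreeGroup

/-- The commutator `[x,y] = x⁻¹y⁻¹xy`. -/
def c (x y : FreeGroup Gen) : FreeGroup Gen := x⁻¹ * y⁻¹ * x * y

/-- The defining relators. -/
def rels (p : ℕ) : Set (FreeGroup Gen) :=
  { c (of .a1) (of .a) * (of Gen.a2)⁻¹,
    c (of .a2) (of .a) * (of Gen.a3)⁻¹,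
    c (of .a3) (of .a) * (of Gen.a4)⁻¹,
    c (of .a) (of .a4),
    c (of .a1) (of .a2),
    c (of .a1) (of .a3),
    c (of .a1) (of .a4),
    c (of .a2) (of .a3),
    c (of .a2) (of .a4),
    c (of .a3) (of .a4),
    (of Gen.a1) ^ p * (of Gen.a2) ^ (p.choose 2) * (of Gen.a3) ^ (p.choose 3) * (of Gen.a4) ^ (p.choose 4) * (of Gen.a3)⁻¹,
    (of Gen.a2) ^ p * (of Gen.a3) ^ (p.choose 2) * (of Gen.a4) ^ (p.choose 3) * (of Gen.a4)⁻¹,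
    (of Gen.a) ^ (p ^ 2),
    (of Gen.a3) ^ p,
    (of Gen.a4) ^ p }

/-- In an abelian-by-cyclic group, every element of the commutator subgroup is a commutator
of an element of the abelian normal subgroup with a generator of the cyclic quotient. -/
theorem exists_eq_commutator_of_mem_commutator {E : Type*} [Group E] (B : Subgroup E)
    [hB : B.Normal] (hcomm : ∀ x ∈ B, ∀ y ∈ B, x * y = y * x) (t : E)
    (htop : B ⊔ Subgroup.zpowers t = ⊤) {z : E} (hz : z ∈ commutator E) :
    ∃ b ∈ B, z = b * t * b⁻¹ * t⁻¹ := by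
  have eq_top (H : Subgroup E) (hBH : B ≤ H) (htH : t ∈ H) : H = ⊤ :=
    top_le_iff.1 (htop ▸ sup_le hBH (Subgroup.zpowers_le.2 htH))
  have hmem : ∀ b ∈ B, b * t * b⁻¹ * t⁻¹ ∈ B := fun b hb => by
    have := B.mul_mem hb (hB.conj_mem _ (B.inv_mem hb) t)
    simpa [mul_assoc] using this
  let K : Subgroup E :=
    { carrier := {x | ∃ b ∈ B, x = b * t * b⁻¹ * t⁻¹}
      one_mem' := ⟨1, B.one_mem, by simp⟩
      mul_mem' := by
        rintro _ _ ⟨b, hb, rfl⟩ ⟨d, hd, rfl⟩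
        refine ⟨d * b, B.mul_mem hd hb, ?_⟩
        have h := hcomm _ (hmem b hb) _ hd
        calc b * t * b⁻¹ * t⁻¹ * (d * t * d⁻¹ * t⁻¹)
            = b * t * b⁻¹ * t⁻¹ * d * (t * d⁻¹ * t⁻¹) := by simp [mul_assoc]
          _ = d * b * t * (d * b)⁻¹ * t⁻¹ := by rw [h]; simp [mul_assoc]
      inv_mem' := by
        rintro _ ⟨b, hb, rfl⟩
        refine ⟨b⁻¹, B.inv_mem hb, ?_⟩
        have h := hcomm _ (hB.conj_mem _ hb t) _ (B.inv_mem hb)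
        calc (b * t * b⁻¹ * t⁻¹)⁻¹ = (t * b * t⁻¹) * b⁻¹ := by simp [mul_assoc]
          _ = b⁻¹ * t * b⁻¹⁻¹ * t⁻¹ := by rw [h]; simp [mul_assoc] }
  have hKB : ∀ x ∈ K, x ∈ B := by
    rintro _ ⟨b, hb, rfl⟩
    exact hmem b hb
  have hK : K.Normal := by
    rw [← Subgroup.normalizer_eq_top_iff]
    apply eq_top
    · intro b hb
      rw [Subgroup.mem_normalizer_iff]
      refine fun h => ⟨fun hh => ?_, fun hh => ?_⟩
      · rwa [hcomm b hb h (hKB h hh), mul_inv_cancel_right]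
      · have h1 := hcomm _ (hKB _ hh) b hb
        rw [inv_mul_cancel_right] at h1
        rwa [← mul_left_cancel h1] at hh
    · rw [Subgroup.mem_normalizer_iff]
      refine fun h => ⟨?_, ?_⟩
      · rintro ⟨b, hb, rfl⟩
        exact ⟨t * b * t⁻¹, hB.conj_mem b hb t, by simp [mul_assoc]⟩
      · rintro ⟨b, hb, hh⟩
        refine ⟨t⁻¹ * b * t, by simpa using hB.conj_mem b hb t⁻¹, ?_⟩
        have : h = t⁻¹ * (t * h * t⁻¹) * t := by group
        rw [this, hh]
        simp [mul_assoc]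
  let q := QuotientGroup.mk' K
  let C (x : E) : Subgroup E := (Subgroup.centralizer {q x}).comap q
  have mem_C {x y : E} : y ∈ C x ↔ q y * q x = q x * q y :=
    Subgroup.mem_centralizer_singleton_iff
  have hqB : ∀ b ∈ B, q b * q t = q t * q b := fun b hb => by
    have h : q (b * t * b⁻¹ * t⁻¹) = 1 := (QuotientGroup.eq_one_iff _).2 ⟨b, hb, rfl⟩
    simp only [_root_.map_mul, _root_.map_inv] at h
    rwa [mul_inv_eq_one, mul_inv_eq_iff_eq_mul] at h
  have hCB : ∀ b ∈ B, C b = ⊤ := fun b hb =>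
    eq_top _ (fun d hd => mem_C.2 (by rw [← _root_.map_mul, ← _root_.map_mul, hcomm b hb d hd]))
      (mem_C.2 (hqB b hb).symm)
  have hCt : C t = ⊤ := eq_top _ (fun b hb => mem_C.2 (hqB b hb)) (mem_C.2 rfl)
  have hC (y : E) : C y = ⊤ := by
    refine eq_top _ (fun b hb => mem_C.2 ?_) (mem_C.2 ?_)
    · exact (mem_C.1 (hCB b hb ▸ Subgroup.mem_top y)).symm
    · exact (mem_C.1 (hCt ▸ Subgroup.mem_top y)).symm
  have hle : commutator E ≤ K := by
    refine Subgroup.commutator_le.2 fun x _ y _ => ?_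
    rw [← QuotientGroup.eq_one_iff]
    have h : q x * q y = q y * q x := mem_C.1 (hC y ▸ Subgroup.mem_top x)
    change q (x * y * x⁻¹ * y⁻¹) = 1
    simp only [_root_.map_mul, _root_.map_inv, h]
    group
  exact hle hz

namespace IsTwoCocycle

variable {G : Type} [Group G] {f : G → G → QZ}

theorem one_left (hf : IsTwoCocycle f) (g : G) : f 1 g = f 1 1 := by
  have h := hf 1 1 g
  simp only [one_mul, sub_self, zero_add] at h
  exact sub_eq_zero.1 h

/-- The central extension of `G` by `ℚ/ℤ` defined by a 2-cocycle. -/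
@[ext]
structure Extension (hf : IsTwoCocycle f) where
  /-- The `ℚ/ℤ`-coordinate. -/
  coeff : QZ
  /-- The underlying element of `G`. -/
  base : G

namespace Extension

variable (hf : IsTwoCocycle f)

instance : Mul hf.Extension := ⟨fun x y => ⟨x.coeff + y.coeff + f x.base y.base, x.base * y.base⟩⟩

instance : One hf.Extension := ⟨⟨-f 1 1, 1⟩⟩

instance : Inv hf.Extension := ⟨fun x => ⟨-x.coeff - f x.base⁻¹ x.base - f 1 1, x.base⁻¹⟩⟩

@[simp]
theorem coeff_mul (x y : hf.Extension) :
    (x * y).coeff = x.coeff + y.coeff + f x.base y.base := rfl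

@[simp]
theorem base_mul (x y : hf.Extension) : (x * y).base = x.base * y.base := rfl

@[simp]
theorem coeff_one : (1 : hf.Extension).coeff = -f 1 1 := rfl

@[simp]
theorem base_one : (1 : hf.Extension).base = 1 := rfl

@[simp]
theorem coeff_inv (x : hf.Extension) :
    x⁻¹.coeff = -x.coeff - f x.base⁻¹ x.base - f 1 1 := rfl

@[simp]
theorem base_inv (x : hf.Extension) : x⁻¹.base = x.base⁻¹ := rfl

instance : Group hf.Extension :=
  Group.ofLeftAxioms
    (fun x y z => by
      ext
      · have h := hf x.base y.base z.base
        simp only [coeff_mul, base_mul]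
        rw [← sub_eq_zero, ← neg_eq_zero, ← h]
        abel
      · exact mul_assoc _ _ _)
    (fun x => by
      ext
      · simp only [coeff_mul, coeff_one, base_one, one_left hf]
        abel
      · exact one_mul _)
    (fun x => by
      ext
      · simp only [coeff_mul, coeff_inv, base_inv, coeff_one]
        abel
      · exact inv_mul_cancel _)

/-- The projection of the central extension onto `G`. -/
def proj : hf.Extension →* G := MonoidHom.mk' base fun _ _ => rfl

/-- The inclusion of the central subgroup `ℚ/ℤ` in the extension. -/
def incl : Multiplicative QZ →* hf.Extension :=
  MonoidHom.mk' (fun z => ⟨z.toAdd - f 1 1, 1⟩) fun x y => by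
    ext
    · simp only [coeff_mul, toAdd_mul]
      abel
    · exact (one_mul _).symm

theorem incl_mul (z : QZ) (x : hf.Extension) :
    incl hf (Multiplicative.ofAdd z) * x = ⟨z + x.coeff, x.base⟩ := by
  ext
  · change z - f 1 1 + x.coeff + f 1 x.base = z + x.coeff
    rw [one_left hf x.base]
    abel
  · exact one_mul _

theorem incl_injective : Function.Injective (incl hf) := fun x y h => by
  have h' : x.toAdd - f 1 1 = y.toAdd - f 1 1 := congrArg coeff h
  exact Multiplicative.toAdd.injective (sub_left_injective h')

theorem proj_surjective : Function.Surjective (proj hf) := fun g => ⟨⟨0, g⟩, rfl⟩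

end Extension

open Extension

/-- A 2-cocycle is a coboundary as soon as the central subgroup `ℚ/ℤ` of its extension meets the
commutator subgroup trivially. -/
theorem isTwoCoboundary_of_incl_mem_commutator_imp (hf : IsTwoCocycle f)
    (h : ∀ z, incl hf z ∈ commutator hf.Extension → z = 1) : IsTwoCoboundary f := by
  let i : QZ →+ Additive (Abelianization hf.Extension) :=
    (Abelianization.of.comp (incl hf)).toAdditiveRight
  have hi : Function.Injective i := by
    refine (injective_iff_map_eq_zero i).2 fun z hz => ?_
    have hz' : Abelianization.of (incl hf (Multiplicative.ofAdd z)) = 1 := hz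
    rw [← MonoidHom.mem_ker, Abelianization.ker_of] at hz'
    exact h _ hz'
  obtain ⟨φ, hφ⟩ :=
    (Module.Baer.of_divisible QZ).extension_property_addMonoidHom i hi (AddMonoidHom.id QZ)
  let ψ (x : hf.Extension) : QZ := φ (Additive.ofMul (Abelianization.of x))
  have ψ_mul (x y : hf.Extension) : ψ (x * y) = ψ x + ψ y := by
    simp only [ψ, _root_.map_mul, ofMul_mul, _root_.map_add]
  have ψ_incl (z : QZ) : ψ (incl hf (Multiplicative.ofAdd z)) = z := DFunLike.congr_fun hφ z
  let u (g : G) : QZ := ψ ⟨0, g⟩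
  refine ⟨u, fun g k => ?_⟩
  have h1 : (⟨0, g⟩ : hf.Extension) * ⟨0, k⟩
      = incl hf (Multiplicative.ofAdd (f g k)) * ⟨0, g * k⟩ := by
    rw [incl_mul]
    ext <;> simp
  have h2 := congrArg ψ h1
  rw [ψ_mul, ψ_mul, ψ_incl] at h2
  change u g + u k = f g k + u (g * k) at h2
  rw [eq_sub_of_add_eq h2.symm]
  abel

/-- If a 2-cocycle restricts to a coboundary on every bicyclic subgroup, then lifts of commuting
elements to the associated central extension commute. -/
theorem Extension.mul_comm_of_proj_mul_comm (hf : IsTwoCocycle f)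
    (hbi : ∀ A : Subgroup G, IsBicyclic A → IsTwoCoboundary (fun a b : ↥A => f ↑a ↑b))
    {x y : hf.Extension} (h : proj hf x * proj hf y = proj hf y * proj hf x) : x * y = y * x := by
  have h' : x.base * y.base = y.base * x.base := h
  let A := Subgroup.closure {x.base, y.base}
  have hA : IsMulCommutative A := Subgroup.isMulCommutative_closure (by
    rintro a (rfl | rfl) b (rfl | rfl) <;> simp [h'])
  obtain ⟨u, hu⟩ := hbi A ⟨fun a b => mul_comm' a b, x.base, y.base, rfl⟩
  let a : A := ⟨x.base, Subgroup.subset_closure (by simp)⟩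
  let b : A := ⟨y.base, Subgroup.subset_closure (by simp)⟩
  have hab : a * b = b * a := Subtype.ext h'
  have hfe : f x.base y.base = f y.base x.base := by
    have h1 : f a b = _ := hu a b
    have h2 : f b a = _ := hu b a
    change f a b = f b a
    rw [h1, h2, hab]
    abel
  ext
  · rw [coeff_mul, coeff_mul, hfe, add_comm x.coeff]
  · exact h'

end IsTwoCocycle

open IsTwoCocycle.Extension in
/-- The Bogomolov multiplier of an abelian-by-cyclic group is trivial. -/
theorem bogomolovMultiplierIsTrivial_of_abelian_by_cyclic {G : Type} [Group G] (A : Subgroup G)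
    [hA : A.Normal] (hcomm : ∀ x ∈ A, ∀ y ∈ A, x * y = y * x) (t : G)
    (htop : A ⊔ Subgroup.zpowers t = ⊤) : BogomolovMultiplierIsTrivial G := by
  intro f hf hbi
  refine hf.isTwoCoboundary_of_incl_mem_commutator_imp fun z hz => ?_
  obtain ⟨s, rfl⟩ := proj_surjective hf t
  have hB : A.comap (proj hf) ⊔ Subgroup.zpowers s = ⊤ := by
    refine eq_top_iff.2 fun x _ => ?_
    obtain ⟨a, ha, b, ⟨n, rfl⟩, hab⟩ :=
      Subgroup.mem_sup_of_normal_left.1 (htop ▸ Subgroup.mem_top (proj hf x))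
    refine Subgroup.mem_sup_of_normal_left.2
      ⟨x * (s ^ n)⁻¹, ?_, s ^ n, ⟨n, rfl⟩, inv_mul_cancel_right _ _⟩
    rw [Subgroup.mem_comap, _root_.map_mul, _root_.map_inv, map_zpow, ← hab, mul_inv_cancel_right]
    exact ha
  obtain ⟨b, -, h⟩ := exists_eq_commutator_of_mem_commutator (A.comap (proj hf))
    (fun x hx y hy => mul_comm_of_proj_mul_comm hf hbi (hcomm _ hx _ hy)) s hB hz
  have hbs : b * s = s * b := by
    apply mul_comm_of_proj_mul_comm hf hbi
    have h1 : proj hf (incl hf z) = 1 := rfl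
    rw [h, _root_.map_mul, _root_.map_mul, _root_.map_mul, _root_.map_inv,
      _root_.map_inv, mul_inv_eq_one, mul_inv_eq_iff_eq_mul] at h1
    exact h1
  refine incl_injective hf ?_
  rw [h, _root_.map_one, hbs]
  group

theorem conj_mem_closure {G : Type*} [Group G] {S : Set G} {g : G}
    (h : ∀ s ∈ S, g * s * g⁻¹ ∈ Subgroup.closure S) {x : G} (hx : x ∈ Subgroup.closure S) :
    g * x * g⁻¹ ∈ Subgroup.closure S := by
  have : Subgroup.closure S ≤ (Subgroup.closure S).comap (MulAut.conj g).toMonoidHom :=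
    (Subgroup.closure_le _).2 h
  exact this hx

/-- A group generated by `t` and pairwise commuting elements `x₁, x₂, x₃, x₄` such that
`[xᵢ, t] = xᵢ₊₁` and `[t, x₄] = 1` has trivial Bogomolov multiplier. -/
theorem bogomolovMultiplierIsTrivial_of_commutator_chain {G : Type} [Group G]
    {t x₁ x₂ x₃ x₄ : G} (hgen : Subgroup.closure {t, x₁, x₂, x₃, x₄} = ⊤)
    (h₁ : t⁻¹ * x₁ * t = x₁ * x₂) (h₂ : t⁻¹ * x₂ * t = x₂ * x₃) (h₃ : t⁻¹ * x₃ * t = x₃ * x₄)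
    (h₄ : Commute t x₄) (h₁₂ : Commute x₁ x₂) (h₁₃ : Commute x₁ x₃) (h₁₄ : Commute x₁ x₄)
    (h₂₃ : Commute x₂ x₃) (h₂₄ : Commute x₂ x₄) (h₃₄ : Commute x₃ x₄) :
    BogomolovMultiplierIsTrivial G := by
  let S : Set G := {x₁, x₂, x₃, x₄}
  let A := Subgroup.closure S
  have m₁ : x₁ ∈ A := Subgroup.subset_closure (by simp [S])
  have m₂ : x₂ ∈ A := Subgroup.subset_closure (by simp [S])
  have m₃ : x₃ ∈ A := Subgroup.subset_closure (by simp [S])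
  have m₄ : x₄ ∈ A := Subgroup.subset_closure (by simp [S])
  have htop : A ⊔ Subgroup.zpowers t = ⊤ := by
    refine top_le_iff.1 (hgen ▸ (Subgroup.closure_le _).2 ?_)
    rintro _ (rfl | rfl | rfl | rfl | rfl)
    · exact Subgroup.mem_sup_right (Subgroup.mem_zpowers _)
    · exact Subgroup.mem_sup_left m₁
    · exact Subgroup.mem_sup_left m₂
    · exact Subgroup.mem_sup_left m₃
    · exact Subgroup.mem_sup_left m₄
  have hcomm : IsMulCommutative A := Subgroup.isMulCommutative_closure (by
    rintro _ (rfl | rfl | rfl | rfl) _ (rfl | rfl | rfl | rfl)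
    exacts [rfl, h₁₂, h₁₃, h₁₄, h₁₂.symm, rfl, h₂₃, h₂₄, h₁₃.symm, h₂₃.symm, rfl, h₃₄,
      h₁₄.symm, h₂₄.symm, h₃₄.symm, rfl])
  have inv_conj : ∀ x ∈ A, t⁻¹ * x * t ∈ A := fun x hx => by
    have := conj_mem_closure (S := S) (g := t⁻¹) ?_ hx
    · rwa [inv_inv] at this
    · rintro _ (rfl | rfl | rfl | rfl) <;> rw [inv_inv]
      · exact h₁ ▸ A.mul_mem m₁ m₂
      · exact h₂ ▸ A.mul_mem m₂ m₃
      · exact h₃ ▸ A.mul_mem m₃ m₄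
      · rwa [mul_assoc, ← h₄.eq, inv_mul_cancel_left]
  have conj_of {x y : G} (hx : x ∈ A) (hy : t * y * t⁻¹ ∈ A) (h : t⁻¹ * x * t = x * y) :
      t * x * t⁻¹ ∈ A := by
    have : t * x * t⁻¹ = x * (t * y * t⁻¹)⁻¹ := by
      calc t * x * t⁻¹ = t * (x * y) * t⁻¹ * (t * y * t⁻¹)⁻¹ := by group
        _ = x * (t * y * t⁻¹)⁻¹ := by rw [← h]; group
    exact this ▸ A.mul_mem hx (A.inv_mem hy)
  have c₄ : t * x₄ * t⁻¹ ∈ A := by rwa [h₄.eq, mul_inv_cancel_right]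
  have c₃ := conj_of m₃ c₄ h₃
  have c₂ := conj_of m₂ c₃ h₂
  have c₁ := conj_of m₁ c₂ h₁
  have conj : ∀ x ∈ A, t * x * t⁻¹ ∈ A := fun x hx =>
    conj_mem_closure (S := S) (by rintro _ (rfl | rfl | rfl | rfl) <;> assumption) hx
  have hnormal : A.Normal := by
    rw [← Subgroup.normalizer_eq_top_iff, ← top_le_iff, ← htop]
    refine sup_le Subgroup.le_normalizer (Subgroup.zpowers_le.2 ?_)
    refine Subgroup.mem_normalizer_iff.2 fun x => ⟨conj x, fun hx => ?_⟩
    have := inv_conj _ hx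
    rwa [show t⁻¹ * (t * x * t⁻¹) * t = x by group] at this
  exact bogomolovMultiplierIsTrivial_of_abelian_by_cyclic A
    (fun x hx y hy => congrArg Subtype.val (mul_comm' (⟨x, hx⟩ : A) ⟨y, hy⟩)) t htop

theorem bogomolov_trivial_Phi25 (p : ℕ) (hp : p.Prime) (h3 : 3 < p)
    (hcard : Nat.card (PresentedGroup (rels p)) = p ^ 6) :
    BogomolovMultiplierIsTrivial (PresentedGroup (rels p)) := by
  have hrel : ∀ r ∈ rels p, PresentedGroup.mk (rels p) r = 1 := fun r hr =>
    PresentedGroup.one_of_mem hr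
  have shift (x y z : Gen) (h : c (of x) (of y) * (of z)⁻¹ ∈ rels p) :
      (PresentedGroup.of y : PresentedGroup (rels p))⁻¹ * PresentedGroup.of x
        * PresentedGroup.of y = PresentedGroup.of x * PresentedGroup.of z := by
    have h' := hrel _ h
    simp only [Stmt5.c, _root_.map_mul, _root_.map_inv] at h'
    rw [mul_inv_eq_one, mul_assoc, mul_assoc, inv_mul_eq_iff_eq_mul, ← mul_assoc] at h'
    exact h'
  have comm (x y : Gen) (h : c (of x) (of y) ∈ rels p) :
      Commute (PresentedGroup.of x : PresentedGroup (rels p)) (PresentedGroup.of y) := by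
    have h' := hrel _ h
    simp only [Stmt5.c, _root_.map_mul, _root_.map_inv] at h'
    rw [mul_assoc, ← mul_inv_rev, inv_mul_eq_one] at h'
    exact h'.symm
  have hgen : Subgroup.closure {PresentedGroup.of Gen.a, PresentedGroup.of Gen.a1,
      PresentedGroup.of Gen.a2, PresentedGroup.of Gen.a3,
      (PresentedGroup.of Gen.a4 : PresentedGroup (rels p))} = ⊤ := by
    rw [← top_le_iff, ← PresentedGroup.closure_range_of]
    refine Subgroup.closure_mono ?_
    rintro _ ⟨_ | _ | _ | _ | _, rfl⟩ <;> simp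
  refine bogomolovMultiplierIsTrivial_of_commutator_chain hgen
    (shift .a1 .a .a2 ?_) (shift .a2 .a .a3 ?_) (shift .a3 .a .a4 ?_) (comm .a .a4 ?_)
    (comm .a1 .a2 ?_) (comm .a1 .a3 ?_) (comm .a1 .a4 ?_) (comm .a2 .a3 ?_) (comm .a2 .a4 ?_)
    (comm .a3 .a4 ?_) <;> simp [rels]

end Stmt5
end

section
/- Let p > 3 be a prime and let G = Φ₃₀(1⁶) be the group of order p⁶ with presentation on generators α, α₁, α₂, α₃, α₄, β and relations [α₁,α] = α₂, [α₂,α] = α₃, [α₃,α] = α₄, [α₁,β] = α₃, [α₂,β] = α₄, α₁ᵖ·α₂^C(p,2)·α₃^C(p,3)·α₄^C(p,4) = 1, α₂ᵖ·α₃^C(p,2)·α₄^C(p,3) = 1, αᵖ = βᵖ = α₃ᵖ = α₄ᵖ = 1, with every commutator of a pair of generators not listed among these relations declared trivial. Then the Bogomolov multiplier B₀(G) is trivial. -/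
/-!
Φ₃₀(1⁶): relations [α₁,α]=α₂, [α₂,α]=α₃, [α₃,α]=α₄, [α₁,β]=α₃, [α₂,β]=α₄,
α₁^(p)=α₂^(p)=1, αᵖ=βᵖ=α₃ᵖ=α₄ᵖ=1.
-/

namespace Stmt7

/-- The additive group `ℚ/ℤ`. -/
abbrev QZ : Type := ℚ ⧸ AddSubgroup.zmultiples (1 : ℚ)

/-- An inhomogeneous 2-cocycle on `G` with values in `ℚ/ℤ` (trivial `G`-action). -/
def IsTwoCocycle {G : Type} [Group G] (f : G → G → QZ) : Prop :=
  ∀ g h j : G, f h j - f (g * h) j + f g (h * j) - f g h = 0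

/-- An inhomogeneous 2-coboundary on `G` with values in `ℚ/ℤ` (trivial `G`-action). -/
def IsTwoCoboundary {G : Type} [Group G] (f : G → G → QZ) : Prop :=
  ∃ c : G → QZ, ∀ g h : G, f g h = c h - c (g * h) + c g

/-- A subgroup is bicyclic if it is abelian and generated by at most two elements
(equivalently, cyclic or a direct product of two cyclic groups). -/
def IsBicyclic {G : Type} [Group G] (A : Subgroup G) : Prop :=
  (∀ x y : A, x * y = y * x) ∧ ∃ a b : G, A = Subgroup.closure {a, b}

/-- The Bogomolov multiplier `B₀(G) ⊆ H²(G, ℚ/ℤ)` is trivial, phrased at the level of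
2-cocycles: every 2-cocycle whose restriction to each bicyclic subgroup is a coboundary
(i.e. whose class restricts to zero on each bicyclic subgroup) is itself a coboundary
(i.e. its class is zero). -/
def BogomolovMultiplierIsTrivial (G : Type) [Group G] : Prop :=
  ∀ f : G → G → QZ, IsTwoCocycle f →
    (∀ A : Subgroup G, IsBicyclic A → IsTwoCoboundary (fun a b : ↥A => f ↑a ↑b)) →
    IsTwoCoboundary f

/-- The Bogomolov multiplier `B₀(G) ⊆ H²(G, ℚ/ℤ)` is nontrivial, phrased at the level of
2-cocycles. -/
def BogomolovMultiplierIsNontrivial (G : Type) [Group G] : Prop :=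
  ∃ f : G → G → QZ, IsTwoCocycle f ∧
    (∀ A : Subgroup G, IsBicyclic A → IsTwoCoboundary (fun a b : ↥A => f ↑a ↑b)) ∧
    ¬ IsTwoCoboundary f

/-- The generators. -/
inductive Gen | a | a1 | a2 | a3 | a4 | b

open FreeGroup

/-- The commutator `[x,y] = x⁻¹y⁻¹xy`. -/
def c (x y : FreeGroup Gen) : FreeGroup Gen := x⁻¹ * y⁻¹ * x * y

/-- The defining relators. -/
def rels (p : ℕ) : Set (FreeGroup Gen) :=
  { c (of .a1) (of .a) * (of Gen.a2)⁻¹,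
    c (of .a2) (of .a) * (of Gen.a3)⁻¹,
    c (of .a3) (of .a) * (of Gen.a4)⁻¹,
    c (of .a1) (of .b) * (of Gen.a3)⁻¹,
    c (of .a2) (of .b) * (of Gen.a4)⁻¹,
    c (of .a) (of .a4),
    c (of .a) (of .b),
    c (of .a1) (of .a2),
    c (of .a1) (of .a3),
    c (of .a1) (of .a4),
    c (of .a2) (of .a3),
    c (of .a2) (of .a4),
    c (of .a3) (of .a4),
    c (of .a3) (of .b),
    c (of .a4) (of .b),
    (of Gen.a1) ^ p * (of Gen.a2) ^ (p.choose 2) * (of Gen.a3) ^ (p.choose 3) * (of Gen.a4) ^ (p.choose 4),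
    (of Gen.a2) ^ p * (of Gen.a3) ^ (p.choose 2) * (of Gen.a4) ^ (p.choose 3),
    (of Gen.a) ^ p,
    (of Gen.b) ^ p,
    (of Gen.a3) ^ p,
    (of Gen.a4) ^ p }

section CentralExtension

variable {G : Type} [Group G] {f : G → G → QZ}

/-- The central extension of `G` by `ℚ/ℤ` determined by a 2-cocycle `f`. -/
@[ext]
structure CocycleExt (f : G → G → QZ) (hf : IsTwoCocycle f) where
  fiber : QZ
  base : G

lemma IsTwoCocycle.one_left (hf : IsTwoCocycle f) (g : G) : f 1 g = f 1 1 := by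
  have h := hf 1 1 g
  simp only [one_mul] at h
  rw [sub_self, zero_add] at h
  exact sub_eq_zero.mp h

lemma IsTwoCocycle.one_right (hf : IsTwoCocycle f) (g : G) : f g 1 = f 1 1 := by
  have h := hf g 1 1
  simp only [mul_one] at h
  rw [sub_add_cancel] at h
  exact (sub_eq_zero.mp h).symm

namespace CocycleExt

variable {hf : IsTwoCocycle f}

instance : Mul (CocycleExt f hf) :=
  ⟨fun x y => ⟨x.fiber + y.fiber + f x.base y.base, x.base * y.base⟩⟩

instance : One (CocycleExt f hf) := ⟨⟨-f 1 1, 1⟩⟩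

instance : Inv (CocycleExt f hf) :=
  ⟨fun x => ⟨-x.fiber - f 1 1 - f x.base⁻¹ x.base, x.base⁻¹⟩⟩

@[simp] lemma base_mul (x y : CocycleExt f hf) : (x * y).base = x.base * y.base := rfl

@[simp] lemma fiber_mul (x y : CocycleExt f hf) :
    (x * y).fiber = x.fiber + y.fiber + f x.base y.base := rfl

@[simp] lemma base_one : (1 : CocycleExt f hf).base = 1 := rfl

@[simp] lemma fiber_one : (1 : CocycleExt f hf).fiber = -f 1 1 := rfl

@[simp] lemma base_inv (x : CocycleExt f hf) : x⁻¹.base = x.base⁻¹ := rfl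

@[simp] lemma fiber_inv (x : CocycleExt f hf) :
    x⁻¹.fiber = -x.fiber - f 1 1 - f x.base⁻¹ x.base := rfl

instance : Group (CocycleExt f hf) :=
  Group.ofLeftAxioms
    (fun x y z => by
      ext
      · have h := hf x.base y.base z.base
        simp only [fiber_mul, base_mul]
        rw [← sub_eq_zero, ← neg_eq_zero, ← h]
        abel
      · simp [mul_assoc])
    (fun x => by
      ext
      · simp only [fiber_mul, fiber_one, base_one, hf.one_left]
        abel
      · simp)
    (fun x => by
      ext
      · simp only [fiber_mul, fiber_inv, base_inv, fiber_one]
        abel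
      · simp)

/-- The projection of the extension onto `G`. -/
def proj : CocycleExt f hf →* G where
  toFun := base
  map_one' := rfl
  map_mul' _ _ := rfl

@[simp] lemma proj_apply (x : CocycleExt f hf) : proj x = x.base := rfl

lemma proj_surjective : Function.Surjective (proj : CocycleExt f hf →* G) :=
  fun g => ⟨⟨0, g⟩, rfl⟩

/-- The inclusion of `ℚ/ℤ` in the extension. -/
def incl : Multiplicative QZ →* CocycleExt f hf where
  toFun t := ⟨t.toAdd - f 1 1, 1⟩
  map_one' := by ext <;> simp
  map_mul' s t := by
    ext
    · simp only [fiber_mul, toAdd_mul]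
      abel
    · simp

lemma exists_pow_eq_of_proj_eq_one {n : ℕ} (hn : n ≠ 0) (k : CocycleExt f hf)
    (hk : proj k = 1) : ∃ r : CocycleExt f hf, proj r = 1 ∧ r ^ n = k := by
  obtain ⟨q, hq⟩ := QuotientAddGroup.mk_surjective (k.fiber + f 1 1)
  refine ⟨incl (Multiplicative.ofAdd (QuotientAddGroup.mk (q / n))), rfl, ?_⟩
  rw [← map_pow, ← ofAdd_nsmul, ← QuotientAddGroup.mk_nsmul, nsmul_eq_mul,
    mul_div_cancel₀ q (Nat.cast_ne_zero.mpr hn), hq]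
  ext
  · simp [incl]
  · exact hk.symm

lemma commute_of_proj
    (hres : ∀ A : Subgroup G, IsBicyclic A → IsTwoCoboundary (fun a b : ↥A => f ↑a ↑b))
    {x y : CocycleExt f hf} (hxy : Commute (proj x) (proj y)) : Commute x y := by
  have hcomm : ∀ u ∈ ({proj x, proj y} : Set G), ∀ v ∈ ({proj x, proj y} : Set G),
      u * v = v * u := by
    rintro u (rfl | rfl) v (rfl | rfl)
    · rfl
    · exact hxy
    · exact hxy.symm
    · rfl
  obtain ⟨c, hc⟩ := hres (Subgroup.closure {proj x, proj y})
    ⟨(Subgroup.isMulCommutative_closure hcomm).is_comm.comm, _, _, rfl⟩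
  let u : Subgroup.closure {proj x, proj y} := ⟨proj x, Subgroup.subset_closure (by simp)⟩
  let v : Subgroup.closure {proj x, proj y} := ⟨proj y, Subgroup.subset_closure (by simp)⟩
  have huv : u * v = v * u := Subtype.ext hxy
  have h : f (proj x) (proj y) = f (proj y) (proj x) := by
    have h₁ := hc u v
    have h₂ := hc v u
    rw [huv] at h₁
    change f (proj x) (proj y) = _ at h₁
    change f (proj y) (proj x) = _ at h₂
    rw [h₁, h₂]
    abel
  ext
  · simp only [fiber_mul]
    rw [proj_apply, proj_apply] at h
    rw [h, add_comm x.fiber]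
  · exact hxy

lemma isTwoCoboundary_of_section (s : G →* CocycleExt f hf) (hs : ∀ g, proj (s g) = g) :
    IsTwoCoboundary f := by
  refine ⟨fun g => -(s g).fiber, fun g h => ?_⟩
  have e : (s (g * h)).fiber = (s g).fiber + (s h).fiber + f g h := by
    rw [_root_.map_mul, fiber_mul, ← proj_apply, ← proj_apply, hs, hs]
  simp only [e]
  abel

end CocycleExt

end CentralExtension

section Commutators

variable {E : Type*} [Group E]

lemma semiconjBy_of_commutator_eq {x a y : E} (h : x⁻¹ * a⁻¹ * x * a = y) :
    SemiconjBy a (x * y) x := by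
  rw [← h]
  simp only [SemiconjBy]
  group

lemma commute_of_commutator_eq_one {x y : E} (h : x⁻¹ * y⁻¹ * x * y = 1) : Commute x y := by
  have h' := semiconjBy_of_commutator_eq h
  rw [mul_one] at h'
  exact h'.symm

lemma commutator_eq_of_semiconjBy {x a y : E} (h : SemiconjBy a (x * y) x) :
    x⁻¹ * a⁻¹ * x * a = y := by
  have h' : x * a = a * (x * y) := h.symm
  rw [mul_assoc, h']
  group

lemma SemiconjBy.pow_binomial {a x y z w : E} (hx : SemiconjBy a (x * y) x)
    (hy : SemiconjBy a (y * z) y) (hz : SemiconjBy a (z * w) z) (hw : SemiconjBy a w w)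
    (hyz : Commute y z) (hzw : Commute z w) (n : ℕ) :
    SemiconjBy (a ^ n) (x * (y ^ n * z ^ n.choose 2 * w ^ n.choose 3)) x := by
  induction n with
  | zero => simp [SemiconjBy]
  | succ n ih =>
    have h := hx.mul_right (((hy.pow_right n).mul_right
      (hz.pow_right (n.choose 2))).mul_right (hw.pow_right (n.choose 3)))
    have h' := ih.mul_left h
    rw [← pow_succ] at h'
    have e₂ : (n + 1).choose 2 = n + n.choose 2 := by
      rw [Nat.choose_succ_succ' n 1, Nat.choose_one_right]
    have e₃ : (n + 1).choose 3 = n.choose 2 + n.choose 3 := Nat.choose_succ_succ' n 2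
    rw [hyz.mul_pow, hzw.mul_pow] at h'
    rw [e₂, e₃, pow_succ' y, pow_add z, pow_add w]
    simpa only [mul_assoc] using h'

/-- If `a ^ n = 1`, then the binomial product appearing in `x ^ (a ^ n)` is trivial. -/
lemma SemiconjBy.binomial_eq_one {a x y z w : E} (hx : SemiconjBy a (x * y) x)
    (hy : SemiconjBy a (y * z) y) (hz : SemiconjBy a (z * w) z) (hw : SemiconjBy a w w)
    (hyz : Commute y z) (hzw : Commute z w) {n : ℕ} (ha : a ^ n = 1) :
    y ^ n * z ^ n.choose 2 * w ^ n.choose 3 = 1 := by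
  have h := SemiconjBy.pow_binomial hx hy hz hw hyz hzw n
  rw [ha] at h
  simpa [SemiconjBy] using h

variable {a b x y z w : E}

lemma commute_mul_mul (hb : SemiconjBy b (x * z) x) (ha : SemiconjBy a (y * z) y)
    (hxy : Commute x y) (hxz : Commute x z) (hyz : Commute y z) (hab : Commute a b) :
    Commute (b * y) (a * x) :=
  calc b * y * (a * x) = b * (y * a) * x := by group
    _ = b * a * (y * (z * x)) := by
      rw [← ha.eq]
      group
    _ = a * b * (y * (x * z)) := by rw [hab.eq, hxz.eq]
    _ = a * (b * (x * z)) * y := by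
      rw [← mul_assoc y, ← hxy.eq, mul_assoc x, hyz.eq]
      group
    _ = a * x * (b * y) := by
      rw [hb.eq]
      group

lemma semiconjBy_of_commute_mul_mul (h : Commute (b * y) (a * x)) (ha : SemiconjBy a (y * z) y)
    (hxy : Commute x y) (hxz : Commute x z) (hyz : Commute y z) (hab : Commute a b) :
    SemiconjBy b (x * z) x := by
  have e : a * (b * (x * z)) * y = a * (x * b) * y :=
    calc a * (b * (x * z)) * y = a * b * (y * (x * z)) := by
          rw [← mul_assoc y, ← hxy.eq, mul_assoc x y, hyz.eq]
          group
      _ = b * a * (y * (z * x)) := by rw [hab.eq, hxz.eq]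
      _ = b * (a * (y * z)) * x := by group
      _ = b * y * (a * x) := by
          rw [ha.eq]
          group
      _ = a * x * (b * y) := h.eq
      _ = a * (x * b) * y := by group
  exact mul_left_cancel (mul_right_cancel e)

/-- If `b` commutes with `a` and sends `x` to `x * z`, then it acts on `y = [x, a]` by
`w = [z, a]`. -/
lemma semiconjBy_of_commute (hx : SemiconjBy a (x * y) x) (hz : SemiconjBy a (z * w) z)
    (hb : SemiconjBy b (x * z) x) (hyz : Commute y z) (hab : Commute a b) :
    SemiconjBy b (y * w) y := by
  have e : a * x * (b * (y * w)) = a * x * (y * b) :=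
    calc a * x * (b * (y * w)) = a * (x * b) * (y * w) := by group
      _ = a * b * (x * (z * y) * w) := by
          rw [← hb.eq]
          group
      _ = b * (a * (x * y) * (z * w)) := by
          rw [hab.eq, ← hyz.eq]
          group
      _ = b * (x * (a * (z * w))) := by
          rw [hx.eq]
          group
      _ = b * (x * z) * a := by
          rw [hz.eq]
          group
      _ = x * a * b := by rw [hb.eq, mul_assoc, ← hab.eq, mul_assoc]
      _ = a * x * (y * b) := by
          rw [← hx.eq]
          group
  exact mul_left_cancel e

end Commutators

section Lifting

variable {p : ℕ}

lemma mk_eq_one_of_mem {r : FreeGroup Gen} (hr : r ∈ rels p) : PresentedGroup.mk (rels p) r = 1 :=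
  PresentedGroup.one_of_mem hr

lemma of_commutator_eq {x y z : Gen} (hr : c (.of x) (.of y) * (FreeGroup.of z)⁻¹ ∈ rels p) :
    (PresentedGroup.of (rels := rels p) x)⁻¹ * (PresentedGroup.of y)⁻¹ * PresentedGroup.of x *
      PresentedGroup.of y = PresentedGroup.of z :=
  mul_inv_eq_one.mp (mk_eq_one_of_mem hr)

lemma of_commute {x y : Gen} (hr : c (.of x) (.of y) ∈ rels p) :
    Commute (PresentedGroup.of (rels := rels p) x) (PresentedGroup.of y) :=
  commute_of_commutator_eq_one (mk_eq_one_of_mem hr)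

lemma of_pow_eq_one {x : Gen} (hr : (FreeGroup.of x) ^ p ∈ rels p) :
    (PresentedGroup.of (rels := rels p) x) ^ p = 1 :=
  mk_eq_one_of_mem hr

lemma pow_choose_eq_one {E : Type*} [Group E] (hp : p.Prime) {k : ℕ} (hk : k ≠ 0) (hkp : k < p)
    {x : E} (hx : x ^ p = 1) : x ^ p.choose k = 1 := by
  obtain ⟨m, hm⟩ := hp.dvd_choose_self hk hkp
  rw [hm, pow_mul, hx, one_pow]

/-- A surjection onto `Φ₃₀(1⁶)` with divisible kernel that reflects commutation splits. -/
lemma exists_section {E : Type*} [Group E] (hp : p.Prime) (h3 : 3 < p)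
    (π : E →* PresentedGroup (rels p)) (hsurj : Function.Surjective π)
    (hdiv : ∀ k, π k = 1 → ∃ r, π r = 1 ∧ r ^ p = k)
    (hcomm : ∀ {x y}, Commute (π x) (π y) → Commute x y) :
    ∃ s : PresentedGroup (rels p) →* E, ∀ g, π (s g) = g := by
  have hcentral : ∀ {k}, π k = 1 → ∀ x, Commute k x := fun hk x => hcomm (by
    rw [hk]
    exact Commute.one_left _)
  have hlift : ∀ g, g ^ p = 1 → ∃ x, π x = g ∧ x ^ p = 1 := by
    intro g hg
    obtain ⟨x, rfl⟩ := hsurj g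
    obtain ⟨r, hr, hrp⟩ := hdiv (x ^ p)⁻¹ (by simp [hg])
    refine ⟨r * x, by simp [hr], ?_⟩
    rw [(hcentral hr x).mul_pow, hrp, inv_mul_cancel]
  obtain ⟨A, hA, hAp⟩ := hlift (.of .a) (of_pow_eq_one (by simp [rels]))
  obtain ⟨B, hB, hBp⟩ := hlift (.of .b) (of_pow_eq_one (by simp [rels]))
  obtain ⟨A1', hA1'⟩ := hsurj (.of .a1)
  obtain ⟨A2, hA2'⟩ : ∃ y, A1'⁻¹ * A⁻¹ * A1' * A = y := ⟨_, rfl⟩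
  obtain ⟨A3, hA3'⟩ : ∃ y, A2⁻¹ * A⁻¹ * A2 * A = y := ⟨_, rfl⟩
  obtain ⟨A4, hA4'⟩ : ∃ y, A3⁻¹ * A⁻¹ * A3 * A = y := ⟨_, rfl⟩
  have r12 := of_commutator_eq (p := p) (x := .a1) (y := .a) (z := .a2) (by simp [rels])
  have r23 := of_commutator_eq (p := p) (x := .a2) (y := .a) (z := .a3) (by simp [rels])
  have r34 := of_commutator_eq (p := p) (x := .a3) (y := .a) (z := .a4) (by simp [rels])
  have r13 := of_commutator_eq (p := p) (x := .a1) (y := .b) (z := .a3) (by simp [rels])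
  have hA2 : π A2 = .of .a2 := by simp [← hA2', hA1', hA, r12]
  have hA3 : π A3 = .of .a3 := by simp [← hA3', hA2, hA, r23]
  have hA4 : π A4 = .of .a4 := by simp [← hA4', hA3, hA, r34]
  have q1 : π (A1' ^ p * A2 ^ p.choose 2 * A3 ^ p.choose 3 * A4 ^ p.choose 4)⁻¹ = 1 := by
    rw [_root_.map_inv, inv_eq_one]
    simp only [_root_.map_mul, _root_.map_pow, hA1', hA2, hA3, hA4]
    exact mk_eq_one_of_mem (r := FreeGroup.of Gen.a1 ^ p * FreeGroup.of Gen.a2 ^ p.choose 2 *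
      FreeGroup.of Gen.a3 ^ p.choose 3 * FreeGroup.of Gen.a4 ^ p.choose 4) (by simp [rels])
  obtain ⟨r, hr, hrp⟩ := hdiv _ q1
  obtain ⟨A1, hA1r⟩ : ∃ y, y = r * A1' := ⟨_, rfl⟩
  have hA1 : π A1 = .of .a1 := by simp [hA1r, hr, hA1']
  have hA1p : A1 ^ p * A2 ^ p.choose 2 * A3 ^ p.choose 3 * A4 ^ p.choose 4 = 1 := by
    rw [hA1r, (hcentral hr A1').mul_pow, hrp]
    group
  have s12 : SemiconjBy A (A1 * A2) A1 := by
    rw [hA1r, mul_assoc]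
    exact SemiconjBy.mul_right (hcentral hr A).symm (semiconjBy_of_commutator_eq hA2')
  have s23 := semiconjBy_of_commutator_eq hA3'
  have s34 := semiconjBy_of_commutator_eq hA4'
  have cA4 : Commute A A4 := hcomm (by rw [hA, hA4]; exact of_commute (by simp [rels]))
  have cAB : Commute A B := hcomm (by rw [hA, hB]; exact of_commute (by simp [rels]))
  have c12 : Commute A1 A2 := hcomm (by rw [hA1, hA2]; exact of_commute (by simp [rels]))
  have c13 : Commute A1 A3 := hcomm (by rw [hA1, hA3]; exact of_commute (by simp [rels]))
  have c14 : Commute A1 A4 := hcomm (by rw [hA1, hA4]; exact of_commute (by simp [rels]))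
  have c23 : Commute A2 A3 := hcomm (by rw [hA2, hA3]; exact of_commute (by simp [rels]))
  have c24 : Commute A2 A4 := hcomm (by rw [hA2, hA4]; exact of_commute (by simp [rels]))
  have c34 : Commute A3 A4 := hcomm (by rw [hA3, hA4]; exact of_commute (by simp [rels]))
  have c3B : Commute A3 B := hcomm (by rw [hA3, hB]; exact of_commute (by simp [rels]))
  have c4B : Commute A4 B := hcomm (by rw [hA4, hB]; exact of_commute (by simp [rels]))
  have hBA2 : Commute (B * A2) (A * A1) := by
    refine hcomm ?_
    simp only [_root_.map_mul, hA, hA1, hA2, hB]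
    have t13 := semiconjBy_of_commutator_eq r13
    have t23 := semiconjBy_of_commutator_eq r23
    have u12 : Commute (PresentedGroup.of (rels := rels p) .a1) (.of .a2) :=
      of_commute (by simp [rels])
    have u13 : Commute (PresentedGroup.of (rels := rels p) .a1) (.of .a3) :=
      of_commute (by simp [rels])
    have u23 : Commute (PresentedGroup.of (rels := rels p) .a2) (.of .a3) :=
      of_commute (by simp [rels])
    have uab : Commute (PresentedGroup.of (rels := rels p) .a) (.of .b) :=
      of_commute (by simp [rels])
    exact commute_mul_mul t13 t23 u12 u13 u23 uab
  have s13 : SemiconjBy B (A1 * A3) A1 :=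
    semiconjBy_of_commute_mul_mul hBA2 s23 c12 c13 c23 cAB
  have s24 : SemiconjBy B (A2 * A4) A2 :=
    semiconjBy_of_commute s12 s34 s13 c23 cAB
  have hA2p : A2 ^ p * A3 ^ p.choose 2 * A4 ^ p.choose 3 = 1 :=
    SemiconjBy.binomial_eq_one s12 s23 s34 cA4 c23 c34 hAp
  have hA4p : A4 ^ p = 1 := by
    have h := SemiconjBy.binomial_eq_one (w := 1) (z := 1) s34 (by rwa [mul_one])
      (by simp [SemiconjBy]) (by simp [SemiconjBy]) (Commute.one_right _) (Commute.one_right _) hAp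
    simpa using h
  have hA3p : A3 ^ p = 1 := by
    have h := SemiconjBy.binomial_eq_one (w := 1) s23 s34 (by rwa [mul_one])
      (by simp [SemiconjBy]) c34 (Commute.one_right _) hAp
    simpa [pow_choose_eq_one hp two_ne_zero (by omega) hA4p] using h
  let lift : Gen → E := fun
    | .a => A
    | .a1 => A1
    | .a2 => A2
    | .a3 => A3
    | .a4 => A4
    | .b => B
  have hrels : ∀ r ∈ rels p, FreeGroup.lift lift r = 1 := by
    simp only [rels, Set.mem_insert_iff, Set.mem_singleton_iff, forall_eq_or_imp, forall_eq, c,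
      _root_.map_mul, _root_.map_inv, _root_.map_pow, FreeGroup.lift_apply_of, mul_inv_eq_one, lift]
    have hc : ∀ {x y : E}, Commute x y → x⁻¹ * y⁻¹ * x * y = 1 := fun h =>
      commutator_eq_of_semiconjBy (by rw [mul_one]; exact h.symm)
    exact ⟨commutator_eq_of_semiconjBy s12, hA3', hA4', commutator_eq_of_semiconjBy s13,
      commutator_eq_of_semiconjBy s24, hc cA4, hc cAB, hc c12, hc c13, hc c14, hc c23, hc c24,
      hc c34, hc c3B, hc c4B, hA1p, hA2p, hAp, hBp, hA3p, hA4p⟩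
  refine ⟨PresentedGroup.toGroup hrels, DFunLike.congr_fun
    (?_ : π.comp (PresentedGroup.toGroup hrels) = MonoidHom.id _)⟩
  ext x
  cases x <;> simp [lift, hA, hA1, hA2, hA3, hA4, hB]

end Lifting

theorem bogomolov_trivial_Phi30 (p : ℕ) (hp : p.Prime) (h3 : 3 < p)
    (hcard : Nat.card (PresentedGroup (rels p)) = p ^ 6) :
    BogomolovMultiplierIsTrivial (PresentedGroup (rels p)) := by
  intro f hf hres
  obtain ⟨s, hs⟩ := exists_section hp h3 (CocycleExt.proj : CocycleExt f hf →* _)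
    CocycleExt.proj_surjective (CocycleExt.exists_pow_eq_of_proj_eq_one hp.ne_zero)
    (CocycleExt.commute_of_proj hres)
  exact CocycleExt.isTwoCoboundary_of_section s hs

end Stmt7
end

section
/- Let p be a prime, let k be a field of characteristic different from p, and let K = k(x₁,…,x_{p−1}) be the rational function field in p−1 independent variables over k. Let β be the k-automorphism of K determined by β(x₁) = x₁·x₂ᵖ, β(xᵢ) = xᵢ₊₁ for 2 ≤ i ≤ p−2, and β(x_{p−1}) = (x₁·x₂^(p−1)·x₃^(p−2)·⋯·x_{p−1}²)⁻¹. Then β can be linearized: there exist z₁,…,z_{p−1} ∈ K with K = k(z₁,…,z_{p−1}) and an invertible (p−1)×(p−1) matrix (b_{ij}) over k such that β(zᵢ) = Σⱼ b_{ij}·zⱼ for all i. -/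
namespace Stmt15

open Finset

/-- The companion matrix of `1 + t + ⋯ + t ^ (n + 1)`: the matrix of a cyclic shift of `n + 2`
vectors with sum zero. -/
def cyclicMatrix (k : Type*) [Field k] (n : ℕ) : Matrix (Fin (n + 1)) (Fin (n + 1)) k :=
  Matrix.of (Fin.snoc (fun i : Fin n => Pi.single i.succ 1) (fun _ => -1))

theorem isUnit_det_cyclicMatrix (k : Type*) [Field k] (n : ℕ) :
    IsUnit (cyclicMatrix k n).det := by
  rw [← Matrix.isUnit_iff_isUnit_det, ← Matrix.mulVec_injective_iff_isUnit,
    ← Matrix.coe_mulVecLin, injective_iff_map_eq_zero]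
  intro v hv
  rw [Matrix.mulVecLin_apply] at hv
  have hsucc (i : Fin n) : v i.succ = 0 := by
    simpa [cyclicMatrix, Matrix.mulVec] using congrFun hv i.castSucc
  have hlast : ∑ j, v j = 0 := by
    simpa [cyclicMatrix, Matrix.mulVec, dotProduct] using congrFun hv (Fin.last n)
  rw [Fin.sum_univ_succ] at hlast
  ext i
  refine Fin.cases ?_ hsucc i
  simpa [hsucc] using hlast

section

variable {k K : Type*} [Field k] [Field K] [Algebra k K]

/-- A multiplicative cyclic shift of `n + 2` generators with product one is linearizable as soon as
the sum of the partial products does not vanish and `n + 2` is invertible. -/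
theorem exists_linearization_of_mul_shift (n : ℕ) (hn : ((n + 2 : ℕ) : k) ≠ 0) (β : K ≃ₐ[k] K)
    (y : ℕ → K) (hy : ∀ i ≤ n, y i ≠ 0)
    (hgen : ∀ L : IntermediateField k K, (∀ i ≤ n, y i ∈ L) → L = ⊤)
    (hβ : ∀ i < n, β (y i) = y (i + 1))
    (hβlast : β (y n) = (∏ i ∈ range (n + 1), y i)⁻¹)
    (hsum : ∑ i ∈ range (n + 2), ∏ j ∈ range i, y j ≠ 0) :
    ∃ (z : Fin (n + 1) → K) (b : Matrix (Fin (n + 1)) (Fin (n + 1)) k),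
      IntermediateField.adjoin k (Set.range z) = ⊤ ∧
      IsUnit b.det ∧
      ∀ i, β (z i) = ∑ j, b i j • z j := by
  set q : ℕ → K := fun i => ∏ j ∈ range i, y j with hq
  set d : K := ∑ i ∈ range (n + 2), q i with hd
  have hq_ne (i : ℕ) (hi : i ≤ n + 1) : q i ≠ 0 :=
    prod_ne_zero_iff.2 fun j hj => hy j (by have := mem_range.1 hj; omega)
  have hβq (i : ℕ) (hi : i ≤ n) : β (q i) * y 0 = q (i + 1) := by
    simp only [hq, map_prod, prod_range_succ' _ i]
    congr 1
    exact prod_congr rfl fun j hj => hβ j (by have := mem_range.1 hj; omega)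
  have hβq_last : β (q (n + 1)) * y 0 = 1 := by
    have hstep : q (n + 1) = q n * y n := prod_range_succ _ _
    rw [hstep, map_mul, mul_right_comm, hβq n le_rfl, hβlast]
    exact mul_inv_cancel₀ (hq_ne _ le_rfl)
  have hβd : β d * y 0 = d := by
    rw [hd, map_sum, sum_mul, sum_range_succ, hβq_last, sum_range_succ' q]
    congr 1
    exact sum_congr rfl fun i hi => hβq i (by have := mem_range.1 hi; omega)
  set z : ℕ → K := fun i => q i / d with hz
  have hβz (i : ℕ) (hi : i ≤ n) : β (z i) = z (i + 1) := by
    rw [hz]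
    simp only [map_div₀]
    rw [← hβq i hi, ← mul_div_mul_right (β (q i)) (β d) (hy 0 (Nat.zero_le n)), hβd]
  have hsum_z : ∑ i ∈ range (n + 2), z i = 1 := by
    rw [hz, ← sum_div]
    exact div_self hsum
  have hz_last : z (n + 1) = 1 - ∑ i ∈ range (n + 1), z i := by
    rw [sum_range_succ] at hsum_z
    exact eq_sub_of_add_eq' hsum_z
  set e : k := ((n + 2 : ℕ) : k)⁻¹
  have he_mul : ((n : K) + 2) * algebraMap k K e = 1 := by
    have h := congrArg (algebraMap k K) (mul_inv_cancel₀ hn)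
    rw [map_mul, map_natCast, map_one] at h
    exact_mod_cast h
  refine ⟨fun i => z i - algebraMap k K e, cyclicMatrix k n, ?_, isUnit_det_cyclicMatrix k n, ?_⟩
  · let L := IntermediateField.adjoin k
      (Set.range fun i : Fin (n + 1) => z i - algebraMap k K e)
    have hzL (i : ℕ) (hi : i < n + 1) : z i ∈ L := by
      have h : z i - algebraMap k K e ∈ L := IntermediateField.subset_adjoin _ _ ⟨⟨i, hi⟩, rfl⟩
      simpa using add_mem h (L.algebraMap_mem e)
    have hzL' (i : ℕ) (hi : i ≤ n + 1) : z i ∈ L := by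
      rcases hi.lt_or_eq with hi | rfl
      · exact hzL i hi
      · rw [hz_last]
        exact sub_mem (one_mem L) (sum_mem fun i hi => hzL i (mem_range.1 hi))
    refine hgen L fun i hi => ?_
    have h : y i = z (i + 1) / z i := by
      have hstep : q (i + 1) = q i * y i := prod_range_succ _ _
      have := hq_ne i (by omega)
      simp only [hz, hstep]
      field_simp
    rw [h]
    exact div_mem (hzL' _ (by omega)) (hzL' _ (by omega))
  · intro i
    rw [map_sub, AlgEquiv.commutes, hβz i (Nat.lt_succ_iff.1 i.2)]
    refine Fin.lastCases ?_ (fun i => ?_) i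
    · rw [Fin.val_last, hz_last, ← Fin.sum_univ_eq_sum_range]
      simp only [cyclicMatrix, Matrix.of_apply, Fin.snoc_last, neg_smul, one_smul,
        sum_neg_distrib, sum_sub_distrib, sum_const, card_univ, Fintype.card_fin, nsmul_eq_mul]
      push_cast
      linear_combination -he_mul
    · simp [cyclicMatrix, Pi.single_apply]

/-- The sum of the partial products does not vanish for generators `x 1, …, x n, x (n + 1)`, where
`(x (n + 1))⁻¹` is `x 0` times a monomial in `x 1, …, x n`. -/
theorem sum_prod_ne_zero (n : ℕ) (x : ℕ → K)
    (hx : AlgebraicIndependent k fun i : Fin (n + 1) => x i)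
    (hlast : x (n + 1) = (x 0 * ∏ i ∈ range n, x (i + 1) ^ (n + 1 - i))⁻¹) :
    ∑ i ∈ range (n + 2), ∏ j ∈ range i, x (j + 1) ≠ 0 := by
  intro h
  have hx_ne (i : ℕ) (hi : i < n + 1) : x i ≠ 0 := hx.ne_zero ⟨i, hi⟩
  have hmon : x 0 * ∏ i ∈ range n, x (i + 1) ^ (n + 1 - i) ≠ 0 :=
    mul_ne_zero (hx_ne 0 (by omega)) <| prod_ne_zero_iff.2 fun i hi =>
      pow_ne_zero _ (hx_ne _ (by have := mem_range.1 hi; omega))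
  rw [sum_range_succ, prod_range_succ, hlast] at h
  have hrel : (∑ i ∈ range (n + 1), ∏ j ∈ range i, x (j + 1)) *
      (x 0 * ∏ i ∈ range n, x (i + 1) ^ (n + 1 - i)) + ∏ j ∈ range n, x (j + 1) = 0 := by
    have := congrArg (· * (x 0 * ∏ i ∈ range n, x (i + 1) ^ (n + 1 - i))) h
    simpa only [add_mul, zero_mul, inv_mul_cancel_right₀ hmon] using this
  let v : ℕ → MvPolynomial (Fin (n + 1)) k := fun i => MvPolynomial.X (Fin.ofNat (n + 1) i)
  have hv (i : ℕ) (hi : i < n + 1) :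
      MvPolynomial.aeval (fun i : Fin (n + 1) => x i) (v i) = x i := by
    simp [v, Nat.mod_eq_of_lt hi]
  have hpoly : (∑ i ∈ range (n + 1), ∏ j ∈ range i, v (j + 1)) *
      (v 0 * ∏ i ∈ range n, v (i + 1) ^ (n + 1 - i)) + ∏ j ∈ range n, v (j + 1) = 0 := by
    apply (injective_iff_map_eq_zero _).1 hx
    rw [← hrel]
    simp only [map_add, map_mul, map_sum, map_prod, map_pow]
    rw [hv 0 (by omega)]
    congr 1
    · congr 1
      · refine sum_congr rfl fun i hi => prod_congr rfl fun j hj => hv _ ?_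
        have := mem_range.1 hi
        have := mem_range.1 hj
        omega
      · congr 1
        refine prod_congr rfl fun j hj => ?_
        rw [hv _ (by have := mem_range.1 hj; omega)]
    · exact prod_congr rfl fun j hj => hv _ (by have := mem_range.1 hj; omega)
  have heval := congrArg (MvPolynomial.eval fun i : Fin (n + 1) => if i = 0 then (0 : k) else 1)
    hpoly
  have hv_zero : MvPolynomial.eval (fun i : Fin (n + 1) => if i = 0 then (0 : k) else 1)
      (v 0) = 0 := by
    simp [v]
  have hv_one : MvPolynomial.eval (fun i : Fin (n + 1) => if i = 0 then (0 : k) else 1)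
      (∏ j ∈ range n, v (j + 1)) = 1 := by
    rw [map_prod]
    refine prod_eq_one fun j hj => ?_
    have hj := mem_range.1 hj
    have : ¬n + 1 ∣ j + 1 := Nat.not_dvd_of_pos_of_lt j.succ_pos (by omega)
    simpa [v]
  rw [map_add, map_mul, map_mul, hv_zero, hv_one] at heval
  simp at heval

/-- The shift sends its last element `x (n + 1)` to the inverse of `x 1 * ⋯ * x (n + 1)`. -/
theorem map_shift_last (n : ℕ) (β : K ≃ₐ[k] K) (x : ℕ → K) (hx_ne : ∀ i ≤ n, x i ≠ 0)
    (hlast : x (n + 1) = (x 0 * ∏ i ∈ range n, x (i + 1) ^ (n + 1 - i))⁻¹)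
    (hfirst : 0 < n → β (x 0) = x 0 * x 1 ^ (n + 2))
    (hshift : ∀ i < n, β (x (i + 1)) = x (i + 2))
    (hβn : β (x n) = x (n + 1)) :
    β (x (n + 1)) = (∏ i ∈ range (n + 1), x (i + 1))⁻¹ := by
  rcases n with _ | m
  · rw [hlast]
    simp [hβn]
  have hmon : x 0 * ∏ i ∈ range (m + 1), x (i + 1) ^ (m + 2 - i) ≠ 0 :=
    mul_ne_zero (hx_ne 0 (by omega)) <| prod_ne_zero_iff.2 fun i hi =>
      pow_ne_zero _ (hx_ne _ (by have := mem_range.1 hi; omega))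
  have hlast' : x (m + 2) * (x 0 * ∏ i ∈ range (m + 1), x (i + 1) ^ (m + 2 - i)) = 1 := by
    rw [hlast]
    exact inv_mul_cancel₀ hmon
  have hprod : ∏ i ∈ range (m + 1), β (x (i + 1)) ^ (m + 2 - i) =
      ∏ i ∈ range (m + 1), x (i + 2) ^ (m + 2 - i) :=
    prod_congr rfl fun i hi => by rw [hshift i (mem_range.1 hi)]
  have hreindex : x 1 ^ (m + 3) * ∏ i ∈ range (m + 1), x (i + 2) ^ (m + 2 - i) =
      (∏ i ∈ range (m + 1), x (i + 1) ^ (m + 2 - i)) * (∏ i ∈ range (m + 1), x (i + 1)) *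
        x (m + 2) ^ 2 := by
    have h := prod_range_succ' (fun i => x (i + 1) ^ (m + 3 - i)) (m + 1)
    rw [prod_range_succ] at h
    have hsub : m + 3 - (m + 1) = 2 := by omega
    rw [hsub] at h
    have hsplit : ∏ i ∈ range (m + 1), x (i + 1) ^ (m + 3 - i) =
        (∏ i ∈ range (m + 1), x (i + 1) ^ (m + 2 - i)) * ∏ i ∈ range (m + 1), x (i + 1) := by
      rw [← prod_mul_distrib]
      refine prod_congr rfl fun i hi => ?_
      have := mem_range.1 hi
      rw [← pow_succ]
      congr 1
      omega
    have hsub' (i : ℕ) : m + 3 - (i + 1) = m + 2 - i := by omega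
    simp only [hsub', hsplit] at h
    rw [mul_comm (x 1 ^ (m + 3))]
    exact h.symm
  rw [hlast, map_inv₀, map_mul, hfirst (by omega), map_prod]
  simp only [map_pow]
  rw [hprod, mul_assoc, hreindex, prod_range_succ (fun i => x (i + 1)) (m + 1)]
  congr 1
  linear_combination (∏ i ∈ range (m + 1), x (i + 1)) * x (m + 2) * hlast'

end

theorem linearizable (p : ℕ) (hp : p.Prime)
    (k K : Type) [Field k] [Field K] [Algebra k K]
    (hchar : ringChar k ≠ p)
    -- `K = k(x₁,…,x_{p−1})` is the rational function field in `p−1` variables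
    -- (0-indexed: `x i` stands for `x_{i+1}`)
    (x : Fin (p - 1) → K)
    (hx : AlgebraicIndependent k x)
    (hgen : IntermediateField.adjoin k (Set.range x) = ⊤)
    (β : K ≃ₐ[k] K)
    (hβfirst : ∀ h : 1 < p - 1,
      β (x ⟨0, by omega⟩) = x ⟨0, by omega⟩ * x ⟨1, h⟩ ^ p)
    (hβmid : ∀ (i : Fin (p - 1)) (_ : 1 ≤ (i : ℕ)) (hi : (i : ℕ) + 1 < p - 1),
      β (x i) = x ⟨(i : ℕ) + 1, hi⟩)
    (hβlast : β (x ⟨p - 2, by have := hp.two_le; omega⟩) =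
      (∏ i : Fin (p - 1), x i ^ (if (i : ℕ) = 0 then 1 else p - (i : ℕ)))⁻¹) :
    -- β can be linearized
    ∃ (z : Fin (p - 1) → K) (b : Matrix (Fin (p - 1)) (Fin (p - 1)) k),
      IntermediateField.adjoin k (Set.range z) = ⊤ ∧
      IsUnit b.det ∧
      ∀ i, β (z i) = ∑ j, b i j • z j := by
  obtain ⟨n, rfl⟩ : ∃ n, p = n + 2 := ⟨p - 2, by have := hp.two_le; omega⟩
  change Fin (n + 1) → K at x
  have hn : ((n + 2 : ℕ) : k) ≠ 0 := fun h => by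
    rcases (Nat.dvd_prime hp).1 (ringChar.dvd h) with h | h
    · exact CharP.ringChar_ne_one h
    · exact hchar h
  set X : ℕ → K := fun i => if h : i < n + 1 then x ⟨i, h⟩ else β (x (Fin.last n))
  have hX_lt (i : ℕ) (hi : i < n + 1) : X i = x ⟨i, hi⟩ := dif_pos hi
  have hX_fin : (fun i : Fin (n + 1) => X i) = x := funext fun i => hX_lt i i.2
  have hX_top : X (n + 1) = β (x (Fin.last n)) := dif_neg (lt_irrefl _)
  have hX_ne (i : ℕ) (hi : i < n + 1) : X i ≠ 0 := by
    rw [hX_lt i hi]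
    exact hx.ne_zero _
  have hlast : X (n + 1) = (X 0 * ∏ i ∈ range n, X (i + 1) ^ (n + 1 - i))⁻¹ := by
    rw [hX_top]
    refine hβlast.trans ?_
    congr 1
    refine (Fin.prod_univ_succ (n := n) _).trans ?_
    rw [← Fin.prod_univ_eq_prod_range (fun i => X (i + 1) ^ (n + 1 - i)) n, hX_lt 0 (by omega)]
    congr 1
    · simp
    · refine prod_congr rfl fun i _ => ?_
      rw [hX_lt _ (by omega), if_neg (by simp)]
      congr 1
      simp only [Fin.val_succ]
      omega
  have hβn : β (X n) = X (n + 1) := by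
    rw [hX_top, hX_lt n (by omega)]
    rfl
  have hshift (i : ℕ) (hi : i < n) : β (X (i + 1)) = X (i + 2) := by
    rcases (Nat.succ_le_of_lt hi).lt_or_eq with h | h
    · rw [hX_lt _ (by omega), hX_lt _ (by omega)]
      exact hβmid ⟨i + 1, by omega⟩ (by simp) (by simp only; omega)
    · subst h
      exact hβn
  have hfirst (h : 0 < n) : β (X 0) = X 0 * X 1 ^ (n + 2) := by
    rw [hX_lt 0 (by omega), hX_lt 1 (by omega)]
    exact hβfirst (by omega)
  have hX_succ_ne (i : ℕ) (hi : i ≤ n) : X (i + 1) ≠ 0 := by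
    rcases hi.lt_or_eq with h | rfl
    · exact hX_ne _ (by omega)
    · rw [← hβn]
      exact (map_ne_zero β).2 (hX_ne _ (by omega))
  refine exists_linearization_of_mul_shift n hn β (fun i => X (i + 1)) hX_succ_ne ?_ hshift
    (map_shift_last n β X (fun i hi => hX_ne i (by omega)) hlast hfirst hshift hβn)
    (sum_prod_ne_zero n X (by rwa [hX_fin]) hlast)
  intro L hL
  rw [eq_top_iff, ← hgen, IntermediateField.adjoin_le_iff]
  rintro _ ⟨i, rfl⟩
  refine Fin.cases (motive := fun i : Fin (n + 1) => x i ∈ L) ?_ (fun i => ?_) i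
  · have hM : ∏ i ∈ range n, X (i + 1) ^ (n + 1 - i) ∈ L :=
      prod_mem fun i hi => pow_mem (hL i (mem_range.1 hi).le) _
    have hM_ne : ∏ i ∈ range n, X (i + 1) ^ (n + 1 - i) ≠ 0 :=
      prod_ne_zero_iff.2 fun i hi => pow_ne_zero _ (hX_succ_ne i (mem_range.1 hi).le)
    have h : x 0 = (X (n + 1))⁻¹ / ∏ i ∈ range n, X (i + 1) ^ (n + 1 - i) := by
      rw [hlast, inv_inv, mul_div_cancel_right₀ _ hM_ne]
      exact (hX_lt 0 (by omega)).symm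
    rw [h]
    exact div_mem (inv_mem (hL n le_rfl)) hM
  · have h := hL i i.2.le
    rwa [hX_lt _ (by omega)] at h

end Stmt15
end
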